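/- arXiv:2605.10461 — 6 statements merged into one kernel-verified Lean document; each statement's English description precedes it below -/
import Mathlib

section
/- (Refined Banaszczyk inequality.) Let L be a full-rank lattice in ℝ^n and s > 0. Then for any c ≥ 1 and any t ∈ ℝ^n, the Gaussian mass of the points of the coset L + t lying outside the open ball of radius c·s·√(n/(2π)) centered at the origin satisfies ρ_s((L+t) \ B(0, c·s·√(n/(2π)))) / ρ_s(L) ≤ (c·√e · e^{−c²/2})^n. -/
open MeasureTheory

/-- The Gaussian function `ρ_s(x) = exp(-π‖x‖²/s²)` on `ℝ^n`. -/
noncomputable def rho {n : ℕ} (s : ℝ) (x : EuclideanSpace ℝ (Fin n)) : ℝ :=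
  Real.exp (-Real.pi * ‖x‖ ^ 2 / s ^ 2)

/-- The Gaussian mass `ρ_s(S) = ∑_{v ∈ S} ρ_s(v)` of a set `S ⊆ ℝ^n`. -/
noncomputable def rhoSet {n : ℕ} (s : ℝ) (S : Set (EuclideanSpace ℝ (Fin n))) : ℝ :=
  ∑' v : S, rho s (v : EuclideanSpace ℝ (Fin n))

/-- The coset `L + t = {v + t : v ∈ L}`. -/
def coset {n : ℕ} (L : Submodule ℤ (EuclideanSpace ℝ (Fin n)))
    (t : EuclideanSpace ℝ (Fin n)) : Set (EuclideanSpace ℝ (Fin n)) :=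
  (fun v => v + t) '' (L : Set (EuclideanSpace ℝ (Fin n)))

open scoped ENNReal

namespace BanaszczykAux

/-- The extended nonnegative real valued Gaussian. -/
noncomputable def gr {n : ℕ} (s : ℝ) (x : EuclideanSpace ℝ (Fin n)) : ℝ≥0∞ :=
  ENNReal.ofReal (rho s x)

/-- The Gaussian mass of the coset `L + t`. -/
noncomputable def mass {n : ℕ} (L : Submodule ℤ (EuclideanSpace ℝ (Fin n))) (s : ℝ)
    (t : EuclideanSpace ℝ (Fin n)) : ℝ≥0∞ := ∑' v : L, gr s ((v : EuclideanSpace ℝ (Fin n)) + t)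

variable {n : ℕ} (L : Submodule ℤ (EuclideanSpace ℝ (Fin n)))

lemma rho_pos (s : ℝ) (x : EuclideanSpace ℝ (Fin n)) : 0 < rho s x := Real.exp_pos _

lemma rhoSet_eq (s : ℝ) (S : Set (EuclideanSpace ℝ (Fin n))) :
    rhoSet s S = (∑' v : S, gr s (v : EuclideanSpace ℝ (Fin n))).toReal := by
  unfold rhoSet gr
  rw [ENNReal.tsum_toReal_eq (fun _ => ENNReal.ofReal_ne_top)]
  exact tsum_congr fun v => (ENNReal.toReal_ofReal (rho_pos s _).le).symm

lemma gr_mul (s : ℝ) (x y : EuclideanSpace ℝ (Fin n)) :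
    gr s x * gr s y = gr (Real.sqrt 2 * s) (x + y) * gr (Real.sqrt 2 * s) (x - y) := by
  unfold gr
  rw [← ENNReal.ofReal_mul (rho_pos _ _).le, ← ENNReal.ofReal_mul (rho_pos _ _).le]
  congr 1
  unfold rho
  rw [← Real.exp_add, ← Real.exp_add]
  congr 1
  have h := parallelogram_law_with_norm ℝ x y
  have h2 : (Real.sqrt 2 * s) ^ 2 = 2 * s ^ 2 := by
    rw [mul_pow, Real.sq_sqrt (by norm_num)]
  rw [h2, ← add_div, ← add_div]
  have h3 : -Real.pi * ‖x + y‖ ^ 2 + -Real.pi * ‖x - y‖ ^ 2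
      = 2 * (-Real.pi * ‖x‖ ^ 2 + -Real.pi * ‖y‖ ^ 2) := by
    linear_combination (-Real.pi) * h
  rw [h3, mul_div_mul_left _ _ (by norm_num)]

/-- The doubling map on `L`. -/
abbrev dbl : L →+ L := zsmulAddGroupHom 2

lemma bij : Function.Bijective
    (fun p : (L ⧸ (dbl L).range) × L => (Quotient.out p.1 + (2 : ℤ) • p.2 : L)) := by
  constructor
  · rintro ⟨q, z⟩ ⟨q', z'⟩ h
    simp only at h
    have hq : q = q' := by
      have h1 : ((Quotient.out q + (2 : ℤ) • z : L) : L ⧸ (dbl L).range) = q := by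
        have : (QuotientAddGroup.mk (Quotient.out q) : L ⧸ (dbl L).range)
            = QuotientAddGroup.mk (Quotient.out q + (2 : ℤ) • z : L) := by
          rw [QuotientAddGroup.eq]
          exact ⟨z, by simp⟩
        rw [← this]
        exact Quotient.out_eq q
      have h2 : ((Quotient.out q' + (2 : ℤ) • z' : L) : L ⧸ (dbl L).range) = q' := by
        have : (QuotientAddGroup.mk (Quotient.out q') : L ⧸ (dbl L).range)
            = QuotientAddGroup.mk (Quotient.out q' + (2 : ℤ) • z' : L) := by
          rw [QuotientAddGroup.eq]
          exact ⟨z', by simp⟩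
        rw [← this]
        exact Quotient.out_eq q'
      rw [← h1, ← h2, h]
    subst hq
    have h3 : (2 : ℤ) • z = (2 : ℤ) • z' := add_left_cancel h
    have h4 : z = z' := by
      have h5 := congrArg (fun w : L => (w : EuclideanSpace ℝ (Fin n))) h3
      ext i
      have h6 := congrArg (fun w : EuclideanSpace ℝ (Fin n) => w i) h5
      simpa using h6
    rw [h4]
  · intro b
    have : (QuotientAddGroup.mk (Quotient.out (b : L ⧸ (dbl L).range)) : L ⧸ (dbl L).range)
        = QuotientAddGroup.mk b := Quotient.out_eq _
    rw [QuotientAddGroup.eq] at this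
    obtain ⟨z, hz⟩ := this
    refine ⟨⟨(b : L ⧸ (dbl L).range), z⟩, ?_⟩
    have hz' : (2 : ℤ) • z = -Quotient.out (b : L ⧸ (dbl L).range) + b := hz
    simp only [hz']
    abel

/-- Gaussian mass of a coset of `2L`. -/
noncomputable def half (s : ℝ) (w : EuclideanSpace ℝ (Fin n)) : ℝ≥0∞ :=
  ∑' y : L, gr (Real.sqrt 2 * s) ((2 : ℤ) • (y : EuclideanSpace ℝ (Fin n)) + w)

lemma half_periodic (s : ℝ) (w : EuclideanSpace ℝ (Fin n)) (z : L) :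
    half L s ((2 : ℤ) • (z : EuclideanSpace ℝ (Fin n)) + w) = half L s w := by
  unfold half
  rw [← (Equiv.addRight z).tsum_eq
    (fun y : L => gr (Real.sqrt 2 * s) ((2 : ℤ) • (y : EuclideanSpace ℝ (Fin n)) + w))]
  refine tsum_congr fun y => ?_
  congr 1
  simp only [Equiv.coe_addRight, Submodule.coe_add, smul_add]
  abel

lemma mass_mul (s : ℝ) (t u : EuclideanSpace ℝ (Fin n)) :
    mass L s t * mass L s u = ∑' q : L ⧸ (dbl L).range,
      half L s (((Quotient.out q : L) : EuclideanSpace ℝ (Fin n)) + (t + u)) *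
      half L s (((Quotient.out q : L) : EuclideanSpace ℝ (Fin n)) + (t - u)) := by
  have h1 : mass L s t * mass L s u = ∑' b : L,
      half L s ((b : EuclideanSpace ℝ (Fin n)) + (t + u)) *
        gr (Real.sqrt 2 * s) ((b : EuclideanSpace ℝ (Fin n)) + (t - u)) := by
    unfold mass half
    rw [mul_comm, ← ENNReal.tsum_mul_right]
    simp_rw [← ENNReal.tsum_mul_left, ← ENNReal.tsum_mul_right]
    rw [ENNReal.tsum_comm (α := L) (β := L)
      (f := fun b y => gr (Real.sqrt 2 * s) ((2 : ℤ) • (y : EuclideanSpace ℝ (Fin n)) +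
        ((b : EuclideanSpace ℝ (Fin n)) + (t + u))) *
        gr (Real.sqrt 2 * s) ((b : EuclideanSpace ℝ (Fin n)) + (t - u)))]
    refine tsum_congr fun y => ?_
    rw [← (Equiv.addLeft y).tsum_eq]
    refine tsum_congr fun b => ?_
    rw [mul_comm, gr_mul]
    congr 2
    · simp only [Equiv.coe_addLeft, Submodule.coe_add, two_smul]
      abel
    · simp only [Equiv.coe_addLeft, Submodule.coe_add]
      abel
  rw [h1, ← (Equiv.ofBijective _ (bij L)).tsum_eq, ENNReal.tsum_prod']
  refine tsum_congr fun q => ?_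
  have h2 : ∀ (z : L) (p : EuclideanSpace ℝ (Fin n)),
      (((Quotient.out q + (2 : ℤ) • z : L) : EuclideanSpace ℝ (Fin n)) + p)
      = (2 : ℤ) • (z : EuclideanSpace ℝ (Fin n)) + ((Quotient.out q : L) + p) := by
    intro z p
    simp only [Submodule.coe_add, Submodule.coe_smul]
    abel
  simp only [Equiv.ofBijective_apply, h2, half_periodic]
  rw [ENNReal.tsum_mul_left]
  rfl

lemma amgm (a b : ℝ≥0∞) : 2 * a * b ≤ a ^ 2 + b ^ 2 := by
  rcases le_total a b with h | h
  · obtain ⟨d, rfl⟩ := exists_add_of_le h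
    have : a ^ 2 + (a + d) ^ 2 = 2 * a * (a + d) + d ^ 2 := by ring
    rw [this]; exact le_self_add
  · obtain ⟨d, rfl⟩ := exists_add_of_le h
    have : (b + d) ^ 2 + b ^ 2 = 2 * (b + d) * b + d ^ 2 := by ring
    rw [this]; exact le_self_add

lemma mass_ineq (s : ℝ) (t : EuclideanSpace ℝ (Fin n)) :
    2 * (mass L s t * mass L s t) ≤
      mass L s ((2 : ℤ) • t) * mass L s 0 + mass L s 0 * mass L s 0 := by
  rw [mass_mul, mass_mul, mass_mul, ← ENNReal.tsum_mul_left, ← ENNReal.tsum_add]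
  refine ENNReal.tsum_le_tsum fun q => ?_
  simp only [add_zero, sub_zero, sub_self, two_smul]
  rw [← mul_assoc, ← sq, ← sq]
  exact amgm _ _

lemma mass_periodic (s : ℝ) (t : EuclideanSpace ℝ (Fin n)) (z : L) :
    mass L s (z + t) = mass L s t := by
  unfold mass
  rw [← (Equiv.addRight z).tsum_eq (fun y : L => gr s ((y : EuclideanSpace ℝ (Fin n)) + t))]
  refine tsum_congr fun y => ?_
  congr 1
  simp only [Equiv.coe_addRight, Submodule.coe_add]
  abel

lemma mass_zero_ne_top [DiscreteTopology L] (s : ℝ) (hs : 0 < s) : mass L s 0 ≠ ∞ := by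
  unfold mass gr
  refine Summable.tsum_ofReal_ne_top ?_
  simp only [add_zero]
  set m := Module.finrank ℤ L + 1 with hm
  have hsum := ZLattice.summable_norm_pow_inv L (2 * m) (by omega)
  refine Summable.of_norm_bounded_eventually
    (hsum.mul_left (m.factorial * (s ^ 2 / Real.pi) ^ m)) ?_
  have h0 : ({0}ᶜ : Set L) ∈ Filter.cofinite := (Set.finite_singleton (0 : L)).compl_mem_cofinite
  filter_upwards [h0] with x hx
  have hx' : 0 < ‖x‖ := norm_pos_iff.mpr hx
  rw [Real.norm_of_nonneg (rho_pos _ _).le]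
  unfold rho
  have hu : 0 < Real.pi * ‖x‖ ^ 2 / s ^ 2 := by positivity
  have h1 := Real.pow_div_factorial_le_exp _ hu.le m
  have h2 : -Real.pi * ‖(x : EuclideanSpace ℝ (Fin n))‖ ^ 2 / s ^ 2
      = -(Real.pi * ‖x‖ ^ 2 / s ^ 2) := by
    rw [Submodule.coe_norm]; ring
  rw [h2, Real.exp_neg]
  refine (inv_anti₀ (by positivity) h1).trans (le_of_eq ?_)
  rw [pow_mul, inv_div, div_pow, div_pow, mul_pow, inv_pow, inv_pow]
  field_simp

lemma gr_shift (s R : ℝ) (hs : 0 < s) (x t : EuclideanSpace ℝ (Fin n)) (ht : ‖t‖ ≤ R) :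
    gr s (x + t) ≤ ENNReal.ofReal (Real.exp (Real.pi * R ^ 2 / s ^ 2)) *
      gr (Real.sqrt 2 * s) x := by
  unfold gr
  rw [← ENNReal.ofReal_mul (Real.exp_pos _).le]
  refine ENNReal.ofReal_le_ofReal ?_
  unfold rho
  rw [← Real.exp_add]
  refine Real.exp_le_exp.mpr ?_
  rw [mul_pow, Real.sq_sqrt (by norm_num)]
  have h1 : ‖x‖ ≤ ‖x + t‖ + R := by
    have : x = (x + t) - t := by abel
    calc ‖x‖ = ‖(x + t) - t‖ := by rw [← this]
      _ ≤ ‖x + t‖ + ‖t‖ := norm_sub_le _ _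
      _ ≤ _ := by linarith
  have hR : 0 ≤ R := (norm_nonneg t).trans ht
  have h2 : ‖x‖ ^ 2 ≤ 2 * ‖x + t‖ ^ 2 + 2 * R ^ 2 := by
    have := pow_le_pow_left₀ (norm_nonneg x) h1 2
    nlinarith [sq_nonneg (‖x + t‖ - R)]
  have h3 : Real.pi * R ^ 2 / s ^ 2 + -Real.pi * ‖x‖ ^ 2 / (2 * s ^ 2)
      - (-Real.pi * ‖x + t‖ ^ 2 / s ^ 2)
      = Real.pi / (2 * s ^ 2) * (2 * ‖x + t‖ ^ 2 + 2 * R ^ 2 - ‖x‖ ^ 2) := by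
    field_simp
    ring
  have h4 : 0 ≤ Real.pi / (2 * s ^ 2) * (2 * ‖x + t‖ ^ 2 + 2 * R ^ 2 - ‖x‖ ^ 2) :=
    mul_nonneg (by positivity) (by linarith)
  linarith

lemma mass_bounded [DiscreteTopology L] [IsZLattice ℝ L] (s : ℝ) (hs : 0 < s) :
    ∃ C : ℝ≥0∞, C ≠ ∞ ∧ ∀ t, mass L s t ≤ C := by
  have : Module.Finite ℤ L := ZLattice.module_finite ℝ L
  have : Module.Free ℤ L := ZLattice.module_free ℝ L
  let b := (Module.Free.chooseBasis ℤ L).ofZLatticeBasis ℝ L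
  have hb : Submodule.span ℤ (Set.range b) = L :=
    (Module.Free.chooseBasis ℤ L).ofZLatticeBasis_span ℝ
  set R := ∑ i, ‖b i‖ with hR
  refine ⟨ENNReal.ofReal (Real.exp (Real.pi * R ^ 2 / s ^ 2)) * mass L (Real.sqrt 2 * s) 0,
    ENNReal.mul_ne_top ENNReal.ofReal_ne_top (mass_zero_ne_top L _ (by positivity)), ?_⟩
  intro t
  have hfl : ((ZSpan.floor b t : Submodule.span ℤ (Set.range b)) : EuclideanSpace ℝ (Fin n)) ∈ L := by
    exact hb.le (ZSpan.floor b t).2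
  have ht : t = ((⟨_, hfl⟩ : L) : EuclideanSpace ℝ (Fin n)) + ZSpan.fract b t := by
    rw [ZSpan.fract_apply]; simp
  rw [ht, mass_periodic]
  unfold mass
  rw [← ENNReal.tsum_mul_left]
  refine ENNReal.tsum_le_tsum fun v => ?_
  rw [add_zero]
  exact gr_shift s R hs _ _ (ZSpan.norm_fract_le b t)

lemma mass_le [DiscreteTopology L] [IsZLattice ℝ L] (s : ℝ) (hs : 0 < s)
    (t : EuclideanSpace ℝ (Fin n)) : mass L s t ≤ mass L s 0 := by
  obtain ⟨C, hC, hCb⟩ := mass_bounded L s hs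
  have hft : ∀ t, mass L s t ≠ ∞ := fun t => ne_top_of_le_ne_top hC (hCb t)
  set f : EuclideanSpace ℝ (Fin n) → ℝ := fun t => (mass L s t).toReal with hf
  have hbd : BddAbove (Set.range f) := by
    refine ⟨C.toReal, ?_⟩
    rintro _ ⟨t, rfl⟩
    exact ENNReal.toReal_mono hC (hCb t)
  set M := sSup (Set.range f) with hM
  have hle : ∀ t, f t ≤ M := fun t => le_csSup hbd ⟨t, rfl⟩
  have hnn : ∀ t, 0 ≤ f t := fun t => ENNReal.toReal_nonneg
  have hin : ∀ t, 2 * (f t * f t) ≤ M * f 0 + f 0 * f 0 := by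
    intro t
    have h := ENNReal.toReal_mono (ENNReal.add_ne_top.mpr
      ⟨ENNReal.mul_ne_top (hft _) (hft _), ENNReal.mul_ne_top (hft _) (hft _)⟩) (mass_ineq L s t)
    rw [ENNReal.toReal_add (ENNReal.mul_ne_top (hft _) (hft _))
      (ENNReal.mul_ne_top (hft _) (hft _))] at h
    simp only [ENNReal.toReal_mul, ENNReal.toReal_ofNat] at h
    have h2 := mul_le_mul_of_nonneg_right (hle ((2 : ℤ) • t)) (hnn 0)
    simp only [hf] at h2 ⊢
    linarith
  have hM0 : 0 ≤ M := (hnn 0).trans (hle 0)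
  have hMK : M ≤ Real.sqrt ((M * f 0 + f 0 * f 0) / 2) := by
    refine csSup_le (Set.range_nonempty f) ?_
    rintro _ ⟨t, rfl⟩
    refine Real.le_sqrt_of_sq_le ?_
    have := hin t
    rw [sq]; linarith
  have hMsq : M ^ 2 ≤ (M * f 0 + f 0 * f 0) / 2 := by
    have h0 := hnn 0
    have := pow_le_pow_left₀ hM0 hMK 2
    rwa [Real.sq_sqrt (by positivity)] at this
  have hMf : M ≤ f 0 := by
    have h0 := hnn 0
    by_contra hlt
    push Not at hlt
    nlinarith
  exact (ENNReal.toReal_le_toReal (hft t) (hft 0)).mp ((hle t).trans hMf)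

lemma measurable_gr (s : ℝ) : Measurable (gr s : EuclideanSpace ℝ (Fin n) → ℝ≥0∞) := by
  unfold gr rho
  fun_prop

lemma lintegral_gr (s : ℝ) (hs : 0 < s) :
    ∫⁻ x : EuclideanSpace ℝ (Fin n), gr s x = ENNReal.ofReal (s ^ n) := by
  have h := GaussianFourier.integral_rexp_neg_mul_sq_norm (V := EuclideanSpace ℝ (Fin n))
    (b := Real.pi / s ^ 2) (by positivity)
  have h1 : (Real.pi / (Real.pi / s ^ 2)) ^
      ((Module.finrank ℝ (EuclideanSpace ℝ (Fin n)) : ℝ) / 2) = s ^ n := by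
    have : Real.pi / (Real.pi / s ^ 2) = s ^ 2 := by field_simp
    rw [this, finrank_euclideanSpace_fin, ← Real.rpow_natCast s 2, ← Real.rpow_mul hs.le,
      ← Real.rpow_natCast s n]
    congr 1
    push_cast
    ring
  rw [h1] at h
  have h2 : ∀ x : EuclideanSpace ℝ (Fin n), Real.exp (-(Real.pi / s ^ 2) * ‖x‖ ^ 2) = rho s x := by
    intro x; unfold rho; congr 1; ring
  simp_rw [h2] at h
  rw [← h, ofReal_integral_eq_lintegral_ofReal]
  · rfl
  · by_contra hni
    rw [integral_undef hni] at h
    exact absurd h (by positivity)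
  · exact Filter.Eventually.of_forall fun x => (rho_pos s x).le

lemma gr_conv (s c r : ℝ) (hs : 0 < s) (hc : 1 < c) (hr : 0 < r) (hrc : r ^ 2 = (c ^ 2 - 1) * s ^ 2)
    (x y : EuclideanSpace ℝ (Fin n)) :
    gr r y * gr s (x - y) = gr (c * s) x * gr (r / c) (y - ((c ^ 2 - 1) / c ^ 2) • x) := by
  unfold gr
  rw [← ENNReal.ofReal_mul (rho_pos _ _).le, ← ENNReal.ofReal_mul (rho_pos _ _).le]
  congr 1
  unfold rho
  rw [← Real.exp_add, ← Real.exp_add]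
  congr 1
  rw [norm_sub_sq_real, norm_sub_sq_real, norm_smul, real_inner_smul_right, mul_pow, mul_pow,
    div_pow, hrc, real_inner_comm, Real.norm_eq_abs, sq_abs]
  have hc0 : 0 < c := by linarith
  have hc1 : c ^ 2 - 1 ≠ 0 := by nlinarith
  field_simp
  ring

lemma mass_scale [DiscreteTopology L] [IsZLattice ℝ L] (s c : ℝ) (hs : 0 < s) (hc : 1 ≤ c)
    (t : EuclideanSpace ℝ (Fin n)) :
    mass L (c * s) t ≤ ENNReal.ofReal (c ^ n) * mass L s 0 := by
  rcases hc.eq_or_lt with rfl | hc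
  · simpa using mass_le L s hs t
  have hc0 : 0 < c := by linarith
  have hc1 : 0 < c ^ 2 - 1 := by nlinarith
  set r := Real.sqrt (c ^ 2 - 1) * s with hr
  have hr0 : 0 < r := by positivity
  have hrc : r ^ 2 = (c ^ 2 - 1) * s ^ 2 := by rw [hr, mul_pow, Real.sq_sqrt hc1.le]
  have hcount : Countable L := by
    have : Module.Finite ℤ L := ZLattice.module_finite ℝ L
    infer_instance
  have key : mass L (c * s) t * ENNReal.ofReal ((r / c) ^ n) ≤
      mass L s 0 * ENNReal.ofReal (r ^ n) := by
    calc mass L (c * s) t * ENNReal.ofReal ((r / c) ^ n)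
        = ∑' v : L, ∫⁻ y, gr r y * gr s ((v : EuclideanSpace ℝ (Fin n)) + t - y) := by
          unfold mass
          rw [← ENNReal.tsum_mul_right]
          refine tsum_congr fun v => ?_
          simp_rw [gr_conv s c r hs hc hr0 hrc]
          rw [lintegral_const_mul' _ _ (by exact ENNReal.ofReal_ne_top),
            lintegral_sub_right_eq_self (fun y => gr (r / c) y), lintegral_gr _ (by positivity)]
      _ = ∫⁻ y, gr r y * mass L s (t - y) := by
          rw [← lintegral_tsum]
          · refine lintegral_congr fun y => ?_
            unfold mass
            rw [ENNReal.tsum_mul_left]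
            simp_rw [add_sub_assoc]
          · intro v
            exact ((measurable_gr r).mul ((measurable_gr s).comp (by fun_prop))).aemeasurable
      _ ≤ ∫⁻ y, gr r y * mass L s 0 := lintegral_mono fun y => mul_le_mul_right (mass_le L s hs _) _
      _ = mass L s 0 * ENNReal.ofReal (r ^ n) := by
          rw [lintegral_mul_const _ (measurable_gr r), lintegral_gr r hr0, mul_comm]
  have hsplit : ENNReal.ofReal (r ^ n) = ENNReal.ofReal (c ^ n) * ENNReal.ofReal ((r / c) ^ n) := by
    rw [← ENNReal.ofReal_mul (by positivity), ← mul_pow, mul_div_cancel₀ _ hc0.ne']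
  rw [hsplit, ← mul_assoc, mul_comm (mass L s 0)] at key
  exact (ENNReal.mul_le_mul_iff_left (by simp; positivity) ENNReal.ofReal_ne_top).mp key

lemma gr_tail (s c : ℝ) (hs : 0 < s) (hc : 1 ≤ c) (x : EuclideanSpace ℝ (Fin n))
    (hx : c * s * Real.sqrt (n / (2 * Real.pi)) ≤ ‖x‖) :
    gr s x ≤ ENNReal.ofReal (Real.exp (n * ((1 - c ^ 2) / 2))) * gr (c * s) x := by
  unfold gr
  rw [← ENNReal.ofReal_mul (Real.exp_pos _).le]
  refine ENNReal.ofReal_le_ofReal ?_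
  unfold rho
  rw [← Real.exp_add]
  refine Real.exp_le_exp.mpr ?_
  have hc0 : 0 < c := by linarith
  have hpi := Real.pi_pos
  have h1 := pow_le_pow_left₀ (by positivity) hx 2
  rw [mul_pow, Real.sq_sqrt (by positivity)] at h1
  have h2 : n * ((1 - c ^ 2) / 2) + -Real.pi * ‖x‖ ^ 2 / (c * s) ^ 2
      - (-Real.pi * ‖x‖ ^ 2 / s ^ 2)
      = (c ^ 2 - 1) * Real.pi / (c * s) ^ 2 * (‖x‖ ^ 2 - (c * s) ^ 2 * (n / (2 * Real.pi))) := by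
    field_simp
    ring
  have h3 : 0 ≤ (c ^ 2 - 1) * Real.pi / (c * s) ^ 2 *
      (‖x‖ ^ 2 - (c * s) ^ 2 * (n / (2 * Real.pi))) := by
    have : 0 ≤ c ^ 2 - 1 := by nlinarith
    exact mul_nonneg (by positivity) (by linarith)
  linarith

end BanaszczykAux

open BanaszczykAux in
/-- Refined Banaszczyk inequality:
`ρ_s((L+t) \ B(0, cs√(n/2π))) / ρ_s(L) ≤ (c√e · e^{-c²/2})ⁿ`. -/
theorem refined_banaszczyk (n : ℕ)
    (L : Submodule ℤ (EuclideanSpace ℝ (Fin n))) [DiscreteTopology L] [IsZLattice ℝ L]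
    (s : ℝ) (hs : 0 < s) (c : ℝ) (hc : 1 ≤ c) (t : EuclideanSpace ℝ (Fin n)) :
    rhoSet s (coset L t \ Metric.ball 0 (c * s * Real.sqrt (n / (2 * Real.pi)))) /
        rhoSet s (L : Set (EuclideanSpace ℝ (Fin n))) ≤
      (c * Real.sqrt (Real.exp 1) * Real.exp (-c ^ 2 / 2)) ^ n := by
  have hc0 : 0 < c := by linarith
  set B := Metric.ball (0 : EuclideanSpace ℝ (Fin n)) (c * s * Real.sqrt (n / (2 * Real.pi)))
    with hB
  have hL : ∑' v : (L : Set (EuclideanSpace ℝ (Fin n))), gr s (v : EuclideanSpace ℝ (Fin n))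
      = mass L s 0 := by
    unfold mass
    simp only [add_zero]
    rfl
  have hbound : (c * Real.sqrt (Real.exp 1) * Real.exp (-c ^ 2 / 2)) ^ n
      = Real.exp (n * ((1 - c ^ 2) / 2)) * c ^ n := by
    rw [Real.exp_nat_mul, ← mul_pow, ← Real.exp_half, mul_assoc, ← Real.exp_add, mul_comm c]
    congr 3
    ring
  have hmain : ∑' v : (coset L t \ B : Set _), gr s (v : EuclideanSpace ℝ (Fin n)) ≤
      ENNReal.ofReal ((c * Real.sqrt (Real.exp 1) * Real.exp (-c ^ 2 / 2)) ^ n) * mass L s 0 := by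
    calc ∑' v : (coset L t \ B : Set _), gr s (v : EuclideanSpace ℝ (Fin n))
        ≤ ∑' v : (coset L t \ B : Set _), ENNReal.ofReal (Real.exp (n * ((1 - c ^ 2) / 2))) *
            gr (c * s) (v : EuclideanSpace ℝ (Fin n)) := by
          refine ENNReal.tsum_le_tsum fun v => gr_tail s c hs hc _ ?_
          have := v.2.2
          simpa [hB] using this
      _ ≤ ∑' v : coset L t, ENNReal.ofReal (Real.exp (n * ((1 - c ^ 2) / 2))) *
            gr (c * s) (v : EuclideanSpace ℝ (Fin n)) :=
          ENNReal.tsum_mono_subtype (fun v => ENNReal.ofReal (Real.exp (n * ((1 - c ^ 2) / 2))) *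
            gr (c * s) v) Set.sdiff_subset
      _ = ENNReal.ofReal (Real.exp (n * ((1 - c ^ 2) / 2))) * mass L (c * s) t := by
          rw [ENNReal.tsum_mul_left]
          congr 1
          unfold coset
          rw [tsum_image (fun v => gr (c * s) v) (add_left_injective t).injOn]
          rfl
      _ ≤ ENNReal.ofReal (Real.exp (n * ((1 - c ^ 2) / 2))) *
            (ENNReal.ofReal (c ^ n) * mass L s 0) := by
          gcongr
          exact mass_scale L s c hs hc t
      _ = _ := by
          rw [← mul_assoc, ← ENNReal.ofReal_mul (Real.exp_pos _).le, hbound]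
  rw [rhoSet_eq, rhoSet_eq, hL]
  refine div_le_of_le_mul₀ ENNReal.toReal_nonneg (by positivity) ?_
  have h := ENNReal.toReal_mono
    (ENNReal.mul_ne_top ENNReal.ofReal_ne_top (mass_zero_ne_top L s hs)) hmain
  rwa [ENNReal.toReal_mul, ENNReal.toReal_ofReal (by positivity)] at h
end

section
/- Let L be a full-rank lattice in ℝ^n, s > 0, t ∈ ℝ^n, and c ≥ 1. Then the Gaussian mass of the points of the coset L + t lying outside the open ball of radius c·s·√(n/(2π)) centered at the origin satisfies ρ_s((L+t) \ B(0, c·s·√(n/(2π)))) ≤ e^{−(c²−1)n/2} · ρ_{sc}(L + t). -/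
open MeasureTheory

theorem rho_nonneg' {n : ℕ} (s : ℝ) (x : EuclideanSpace ℝ (Fin n)) : 0 ≤ rho s x :=
  (Real.exp_pos _).le

theorem summable_rho_lattice {n : ℕ}
    (L : Submodule ℤ (EuclideanSpace ℝ (Fin n))) [DiscreteTopology L]
    (s : ℝ) (hs : 0 < s) (t : EuclideanSpace ℝ (Fin n)) :
    Summable (fun z : L => rho s ((z : EuclideanSpace ℝ (Fin n)) + t)) := by
  set m := Module.finrank ℤ L + 1 with hm
  have h1 := (ZLattice.summable_norm_sub_inv_pow L (2 * m) (by omega) (-t)).mul_left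
    ((m.factorial : ℝ) * (s ^ 2 / Real.pi) ^ m)
  refine Summable.of_norm_bounded_eventually h1 ?_
  have hfin : {z : L | (z : EuclideanSpace ℝ (Fin n)) = -t}.Finite := by
    apply Set.Subsingleton.finite
    intro a ha b hb
    exact Subtype.ext (ha.trans hb.symm)
  refine hfin.subset ?_
  intro z hz
  by_contra hne
  apply hz
  have hx : (z : EuclideanSpace ℝ (Fin n)) + t ≠ 0 := fun h => hne (eq_neg_of_add_eq_zero_left h)
  have hx' : 0 < ‖(z : EuclideanSpace ℝ (Fin n)) + t‖ := norm_pos_iff.mpr hx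
  simp only [sub_neg_eq_add, Set.mem_ofPred_eq]
  rw [Real.norm_of_nonneg (rho_nonneg' _ _)]
  unfold rho
  set r := ‖(z : EuclideanSpace ℝ (Fin n)) + t‖
  have hu : 0 < Real.pi * r ^ 2 / s ^ 2 := by positivity
  have h2 := Real.pow_div_factorial_le_exp (Real.pi * r ^ 2 / s ^ 2) hu.le m
  have h3 : -Real.pi * r ^ 2 / s ^ 2 = -(Real.pi * r ^ 2 / s ^ 2) := by ring
  rw [h3, Real.exp_neg]
  have h4 : (m.factorial : ℝ) * (s ^ 2 / Real.pi) ^ m * r⁻¹ ^ (2 * m)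
      = ((Real.pi * r ^ 2 / s ^ 2) ^ m / m.factorial)⁻¹ := by
    rw [inv_div, pow_mul, mul_assoc, ← mul_pow, div_eq_mul_inv (m.factorial : ℝ), ← inv_pow (Real.pi * r ^ 2 / s ^ 2)]
    congr 2
    field_simp
  rw [h4]
  exact inv_anti₀ (by positivity) h2

theorem summable_rho_coset {n : ℕ}
    (L : Submodule ℤ (EuclideanSpace ℝ (Fin n))) [DiscreteTopology L]
    (s : ℝ) (hs : 0 < s) (t : EuclideanSpace ℝ (Fin n)) :
    Summable (fun v : coset L t => rho s (v : EuclideanSpace ℝ (Fin n))) := by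
  let e := Equiv.Set.image (fun v => v + t) (L : Set (EuclideanSpace ℝ (Fin n)))
    (add_left_injective t)
  exact (Equiv.summable_iff e).mp (summable_rho_lattice L s hs t)

theorem rho_tail_pointwise {n : ℕ} (s : ℝ) (hs : 0 < s) (c : ℝ) (hc : 1 ≤ c)
    (x : EuclideanSpace ℝ (Fin n))
    (hx : c * s * Real.sqrt (n / (2 * Real.pi)) ≤ ‖x‖) :
    rho s x ≤ Real.exp (-(c ^ 2 - 1) * n / 2) * rho (s * c) x := by
  unfold rho
  rw [← Real.exp_add, Real.exp_le_exp]
  have hc0 : 0 < c := by linarith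
  have hsq : (c * s) ^ 2 * (n / (2 * Real.pi)) ≤ ‖x‖ ^ 2 := by
    have := pow_le_pow_left₀ (by positivity) hx 2
    rwa [mul_pow, Real.sq_sqrt (by positivity)] at this
  have h1 : (n : ℝ) / 2 ≤ Real.pi * ‖x‖ ^ 2 / (s * c) ^ 2 := by
    rw [le_div_iff₀ (by positivity)]
    calc (n : ℝ) / 2 * (s * c) ^ 2 = Real.pi * ((c * s) ^ 2 * (n / (2 * Real.pi))) := by
          field_simp
      _ ≤ _ := by gcongr
  have h2 : -Real.pi * ‖x‖ ^ 2 / s ^ 2 = -(c ^ 2 * (Real.pi * ‖x‖ ^ 2 / (s * c) ^ 2)) := by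
    field_simp
  have h3 : -Real.pi * ‖x‖ ^ 2 / (s * c) ^ 2 = -(Real.pi * ‖x‖ ^ 2 / (s * c) ^ 2) := by ring
  rw [h2, h3]
  have h4 : 0 ≤ c ^ 2 - 1 := by nlinarith
  nlinarith [mul_le_mul_of_nonneg_left h1 h4]

/-- Tail bound step: `ρ_s((L+t) \ B(0, cs√(n/2π))) ≤ e^{-(c²-1)n/2} · ρ_{sc}(L+t)`. -/
theorem tail_le_exp_mul_rho_coset (n : ℕ)
    (L : Submodule ℤ (EuclideanSpace ℝ (Fin n))) [DiscreteTopology L] [IsZLattice ℝ L]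
    (s : ℝ) (hs : 0 < s) (t : EuclideanSpace ℝ (Fin n)) (c : ℝ) (hc : 1 ≤ c) :
    rhoSet s (coset L t \ Metric.ball 0 (c * s * Real.sqrt (n / (2 * Real.pi)))) ≤
      Real.exp (-(c ^ 2 - 1) * n / 2) * rhoSet (s * c) (coset L t) := by
  have hsc : 0 < s * c := by positivity
  have hS := (summable_rho_coset L (s * c) hsc t).mul_left (Real.exp (-(c ^ 2 - 1) * n / 2))
  unfold rhoSet
  rw [← tsum_mul_left]
  have hsub : coset L t \ Metric.ball 0 (c * s * Real.sqrt (n / (2 * Real.pi))) ⊆ coset L t :=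
    Set.sdiff_subset
  have hinj := Set.inclusion_injective hsub
  have hS' : Summable ((fun v : coset L t => rho s (v : EuclideanSpace ℝ (Fin n))) ∘
      Set.inclusion hsub) := (summable_rho_coset L s hs t).comp_injective hinj
  refine Summable.tsum_le_tsum_of_inj (Set.inclusion hsub) hinj ?_ ?_ ?_ hS
  · intro v _
    exact mul_nonneg (Real.exp_pos _).le (rho_nonneg' _ _)
  · intro v
    refine rho_tail_pointwise s hs c hc _ ?_
    have := v.2.2
    simpa using this
  · exact hS'
end

section
/- Let L be a full-rank lattice in ℝ^n and s > 0. Then for every t ∈ ℝ^n, the Gaussian mass of the coset L + t is at most that of L itself: ρ_s(L + t) ≤ ρ_s(L). -/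
open MeasureTheory

namespace RhoAux

open scoped ENNReal

variable {n : ℕ}

lemma summable_gauss (L : Submodule ℤ (EuclideanSpace ℝ (Fin n))) [DiscreteTopology L]
    [IsZLattice ℝ L] (c : ℝ) (hc : 0 < c) :
    Summable (fun v : L => Real.exp (-(c * ‖(v : EuclideanSpace ℝ (Fin n))‖ ^ 2))) := by
  classical
  set m : ℕ := Module.finrank ℤ L + 1 with hm
  have h1 : Summable fun z : L => ‖z‖⁻¹ ^ (2 * m) :=
    ZLattice.summable_norm_pow_inv L (2 * m) (by omega)
  have h2 : Summable fun z : L => if z = 0 then (1 : ℝ) else 0 :=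
    (hasSum_ite_eq (0 : L) (1 : ℝ)).summable
  refine Summable.of_nonneg_of_le (fun v => (Real.exp_pos _).le) (fun v => ?_)
    ((h1.mul_left ((m.factorial : ℝ) / c ^ m)).add h2)
  by_cases hv : v = 0
  · subst hv
    simp [hm]
  · have hx : 0 < ‖v‖ := norm_pos_iff.mpr hv
    have hcoe : ‖(v : EuclideanSpace ℝ (Fin n))‖ = ‖v‖ := rfl
    rw [hcoe, if_neg hv, add_zero]
    have h3 := Real.pow_div_factorial_le_exp (c * ‖v‖ ^ 2) (by positivity) m
    rw [Real.exp_neg]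
    calc (Real.exp (c * ‖v‖ ^ 2))⁻¹ ≤ ((c * ‖v‖ ^ 2) ^ m / (m.factorial : ℝ))⁻¹ := by
          gcongr
      _ = _ := by
          rw [mul_pow, ← pow_mul, inv_pow]
          field_simp

lemma pi_div_pos (s : ℝ) (hs : 0 < s) : 0 < Real.pi / (2 * s ^ 2) := by
  have := Real.pi_pos
  positivity

lemma rho_nonneg (s : ℝ) (x : EuclideanSpace ℝ (Fin n)) : 0 ≤ rho s x := (Real.exp_pos _).le

/-- Bound of a shifted Gaussian by a wider centered one. -/
lemma rho_shift_le (s : ℝ) (hs : 0 < s) (v t : EuclideanSpace ℝ (Fin n)) :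
    rho s (v + t) ≤ Real.exp (Real.pi * ‖t‖ ^ 2 / s ^ 2) *
      Real.exp (-(Real.pi / (2 * s ^ 2) * ‖v‖ ^ 2)) := by
  unfold rho
  rw [← Real.exp_add, Real.exp_le_exp]
  have h : ‖v‖ ^ 2 ≤ 2 * ‖v + t‖ ^ 2 + 2 * ‖t‖ ^ 2 := by
    have h1 : ‖v‖ ≤ ‖v + t‖ + ‖t‖ := by
      simpa using norm_sub_le (v + t) t
    have := norm_nonneg v
    nlinarith [sq_nonneg (‖v + t‖ - ‖t‖)]
  have hp := Real.pi_pos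
  have : Real.pi * ‖t‖ ^ 2 / s ^ 2 + -(Real.pi / (2 * s ^ 2) * ‖v‖ ^ 2)
      - (-Real.pi * ‖v + t‖ ^ 2 / s ^ 2)
      = Real.pi / (2 * s ^ 2) * (2 * ‖v + t‖ ^ 2 + 2 * ‖t‖ ^ 2 - ‖v‖ ^ 2) := by
    field_simp
    ring
  have h2 : 0 ≤ Real.pi / (2 * s ^ 2) * (2 * ‖v + t‖ ^ 2 + 2 * ‖t‖ ^ 2 - ‖v‖ ^ 2) :=
    mul_nonneg (by positivity) (by linarith)
  linarith

lemma summable_rho (L : Submodule ℤ (EuclideanSpace ℝ (Fin n))) [DiscreteTopology L]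
    [IsZLattice ℝ L] (s : ℝ) (hs : 0 < s) (t : EuclideanSpace ℝ (Fin n)) :
    Summable (fun v : L => rho s ((v : EuclideanSpace ℝ (Fin n)) + t)) := by
  have h1 := summable_gauss L (Real.pi / (2 * s ^ 2)) (pi_div_pos s hs)
  have h2 := h1.mul_left (Real.exp (Real.pi * ‖t‖ ^ 2 / s ^ 2))
  have h3 : ∀ v : L, 0 ≤ rho s ((v : EuclideanSpace ℝ (Fin n)) + t) := fun v => rho_nonneg s _
  have h4 : ∀ v : L, rho s ((v : EuclideanSpace ℝ (Fin n)) + t) ≤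
      Real.exp (Real.pi * ‖t‖ ^ 2 / s ^ 2) *
      Real.exp (-(Real.pi / (2 * s ^ 2) * ‖(v : EuclideanSpace ℝ (Fin n))‖ ^ 2)) :=
    fun v => rho_shift_le s hs (v : EuclideanSpace ℝ (Fin n)) t
  exact Summable.of_nonneg_of_le h3 h4 h2

/-- The Gaussian mass of the coset, as a sum over the lattice. -/
noncomputable def F (L : Submodule ℤ (EuclideanSpace ℝ (Fin n))) (s : ℝ)
    (t : EuclideanSpace ℝ (Fin n)) : ℝ :=
  ∑' v : L, rho s ((v : EuclideanSpace ℝ (Fin n)) + t)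

lemma F_periodic (L : Submodule ℤ (EuclideanSpace ℝ (Fin n))) (s : ℝ)
    (t : EuclideanSpace ℝ (Fin n)) (w : L) : F L s (w + t) = F L s t := by
  unfold F
  rw [← (Equiv.addRight w).tsum_eq (fun v : L => rho s ((v : EuclideanSpace ℝ (Fin n)) + t))]
  simp [add_assoc]

lemma F_bdd_ball (L : Submodule ℤ (EuclideanSpace ℝ (Fin n))) [DiscreteTopology L]
    [IsZLattice ℝ L] (s : ℝ) (hs : 0 < s) (R : ℝ) : ∃ C, ∀ t, ‖t‖ ≤ R → F L s t ≤ C := by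
  have h1 := summable_gauss L (Real.pi / (2 * s ^ 2)) (pi_div_pos s hs)
  have h2 := h1.mul_left (Real.exp (Real.pi * R ^ 2 / s ^ 2))
  refine ⟨∑' v : L, Real.exp (Real.pi * R ^ 2 / s ^ 2) *
      Real.exp (-(Real.pi / (2 * s ^ 2) * ‖(v : EuclideanSpace ℝ (Fin n))‖ ^ 2)), fun t ht => ?_⟩
  have h3 : Real.exp (Real.pi * ‖t‖ ^ 2 / s ^ 2) ≤ Real.exp (Real.pi * R ^ 2 / s ^ 2) := by
    have := Real.pi_pos
    gcongr
  have h4 : ∀ v : L, rho s ((v : EuclideanSpace ℝ (Fin n)) + t) ≤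
      Real.exp (Real.pi * R ^ 2 / s ^ 2) *
      Real.exp (-(Real.pi / (2 * s ^ 2) * ‖(v : EuclideanSpace ℝ (Fin n))‖ ^ 2)) :=
    fun v => (rho_shift_le s hs (v : EuclideanSpace ℝ (Fin n)) t).trans
      (mul_le_mul_of_nonneg_right h3 (Real.exp_pos _).le)
  exact Summable.tsum_le_tsum h4 (summable_rho L s hs t) h2

lemma F_bdd (L : Submodule ℤ (EuclideanSpace ℝ (Fin n))) [DiscreteTopology L]
    [IsZLattice ℝ L] (s : ℝ) (hs : 0 < s) : ∃ C, ∀ t, F L s t ≤ C := by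
  let b := (Module.Free.chooseBasis ℤ L).ofZLatticeBasis ℝ
  have hb : Submodule.span ℤ (Set.range b) = L :=
    (Module.Free.chooseBasis ℤ L).ofZLatticeBasis_span ℝ
  obtain ⟨C, hC⟩ := F_bdd_ball L s hs (∑ i, ‖b i‖)
  refine ⟨C, fun t => ?_⟩
  have hw : (ZSpan.floor b t : EuclideanSpace ℝ (Fin n)) ∈ L := hb.le (ZSpan.floor b t).2
  have hp := F_periodic L s (ZSpan.fract b t) ⟨_, hw⟩
  have ht : (ZSpan.floor b t : EuclideanSpace ℝ (Fin n)) + ZSpan.fract b t = t := by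
    rw [ZSpan.fract_apply]
    abel
  simp only [ht] at hp
  rw [hp]
  exact hC _ (ZSpan.norm_fract_le b t)

lemma amgm (a b : ℝ≥0∞) : 2 * (a * b) ≤ a * a + b * b := by
  rcases eq_or_ne a ⊤ with rfl | ha
  · simp
  rcases eq_or_ne b ⊤ with rfl | hb
  · simp
  lift a to NNReal using ha
  lift b to NNReal using hb
  norm_cast
  have := two_mul_le_add_sq a b
  simpa [sq, mul_assoc] using this

/-- Unfolding over classes modulo `2G`. -/
lemma unfold_sum {G : Type} [AddCommGroup G] (h2 : Function.Injective (fun w : G => w + w)) :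
    ∃ (Q : Type) (π : G → Q), ∀ a b : G → ℝ≥0∞,
      ∑' v, ∑' w, a (v + w) * b (v - w) =
        ∑' c, (∑' p, (π ⁻¹' {c}).indicator a p) * (∑' p, (π ⁻¹' {c}).indicator b p) := by
  classical
  let H : AddSubgroup G := (nsmulAddMonoidHom (α := G) 2).range
  refine ⟨G ⧸ H, fun p => (p : G ⧸ H), fun a b => ?_⟩
  have step : ∀ p : G, ∑' q, ((fun p : G => (p : G ⧸ H)) ⁻¹' {(p : G ⧸ H)}).indicator b q
      = ∑' w, b (p - (w + w)) := by
    intro p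
    have hinj : Function.Injective (fun w : G => p - (w + w)) := fun x y hxy => by
      apply h2
      simpa using hxy
    rw [← hinj.tsum_eq]
    · refine tsum_congr fun w => ?_
      rw [Set.indicator_of_mem]
      simp only [Set.mem_preimage, Set.mem_singleton_iff]
      rw [QuotientAddGroup.eq]
      exact ⟨w, by simp [two_nsmul]⟩
    · intro q hq
      have hq' := Set.mem_of_indicator_ne_zero hq
      simp only [Set.mem_preimage, Set.mem_singleton_iff] at hq'
      rw [QuotientAddGroup.eq] at hq'
      obtain ⟨w, hw⟩ := hq'
      refine ⟨w, ?_⟩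
      simp only [nsmulAddMonoidHom_apply, two_nsmul] at hw
      simp only [hw]
      abel
  calc ∑' v, ∑' w, a (v + w) * b (v - w) = ∑' w, ∑' v, a (v + w) * b (v - w) :=
        ENNReal.tsum_comm
    _ = ∑' w, ∑' p, a p * b (p - (w + w)) := by
        refine tsum_congr fun w => ?_
        rw [← (Equiv.addRight w).tsum_eq (fun p => a p * b (p - (w + w)))]
        refine tsum_congr fun v => ?_
        simp only [Equiv.coe_addRight]
        congr 2
        abel
    _ = ∑' p, ∑' w, a p * b (p - (w + w)) := ENNReal.tsum_comm
    _ = ∑' p, a p * ∑' q, ((fun p : G => (p : G ⧸ H)) ⁻¹' {(p : G ⧸ H)}).indicator b q := by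
        refine tsum_congr fun p => ?_
        rw [step, ENNReal.tsum_mul_left]
    _ = ∑' p, ∑' c, ((fun p : G => (p : G ⧸ H)) ⁻¹' {c}).indicator a p *
          ∑' q, ((fun p : G => (p : G ⧸ H)) ⁻¹' {c}).indicator b q := by
        refine tsum_congr fun p => ?_
        rw [tsum_eq_single (p : G ⧸ H)]
        · rw [Set.indicator_of_mem]
          simp
        · intro c hc
          rw [Set.indicator_of_notMem, zero_mul]
          simpa using hc.symm
    _ = ∑' c, ∑' p, ((fun p : G => (p : G ⧸ H)) ⁻¹' {c}).indicator a p *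
          ∑' q, ((fun p : G => (p : G ⧸ H)) ⁻¹' {c}).indicator b q := ENNReal.tsum_comm
    _ = _ := by
        refine tsum_congr fun c => ?_
        rw [ENNReal.tsum_mul_right]

/-- The wider Gaussian. -/
noncomputable def k (s : ℝ) (x : EuclideanSpace ℝ (Fin n)) : ℝ :=
  Real.exp (-Real.pi * ‖x‖ ^ 2 / (2 * s ^ 2))

lemma rho_mul (s : ℝ) (hs : 0 < s) (x y : EuclideanSpace ℝ (Fin n)) :
    rho s x * rho s y = k s (x + y) * k s (x - y) := by
  unfold rho k
  rw [← Real.exp_add, ← Real.exp_add]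
  congr 1
  have := parallelogram_law_with_norm ℝ x y
  field_simp
  nlinarith

lemma ofReal_F (L : Submodule ℤ (EuclideanSpace ℝ (Fin n))) [DiscreteTopology L]
    [IsZLattice ℝ L] (s : ℝ) (hs : 0 < s) (t : EuclideanSpace ℝ (Fin n)) :
    ENNReal.ofReal (F L s t) =
      ∑' v : L, ENNReal.ofReal (rho s ((v : EuclideanSpace ℝ (Fin n)) + t)) :=
  ENNReal.ofReal_tsum_of_nonneg (fun _ => (Real.exp_pos _).le) (summable_rho L s hs t)

lemma F_nonneg (L : Submodule ℤ (EuclideanSpace ℝ (Fin n))) (s : ℝ)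
    (t : EuclideanSpace ℝ (Fin n)) : 0 ≤ F L s t :=
  tsum_nonneg fun _ => (Real.exp_pos _).le

lemma F_mul (L : Submodule ℤ (EuclideanSpace ℝ (Fin n))) [DiscreteTopology L]
    [IsZLattice ℝ L] (s : ℝ) (hs : 0 < s) (x y : EuclideanSpace ℝ (Fin n)) :
    ENNReal.ofReal (F L s x) * ENNReal.ofReal (F L s y) =
      ∑' v : L, ∑' w : L,
        ENNReal.ofReal (k s (((v + w : L) : EuclideanSpace ℝ (Fin n)) + (x + y))) *
        ENNReal.ofReal (k s (((v - w : L) : EuclideanSpace ℝ (Fin n)) + (x - y))) := by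
  rw [ofReal_F L s hs, ofReal_F L s hs, ← ENNReal.tsum_mul_right]
  refine tsum_congr fun v => ?_
  rw [← ENNReal.tsum_mul_left]
  refine tsum_congr fun w => ?_
  rw [← ENNReal.ofReal_mul (rho_nonneg _ _),
    ← ENNReal.ofReal_mul (show 0 ≤ k s _ from (Real.exp_pos _).le),
    rho_mul s hs]
  have e1 : (v : EuclideanSpace ℝ (Fin n)) + x + (w + y) = ((v + w : L) : _) + (x + y) := by
    rw [Submodule.coe_add]
    abel
  have e2 : (v : EuclideanSpace ℝ (Fin n)) + x - (w + y) = ((v - w : L) : _) + (x - y) := by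
    rw [Submodule.coe_sub]
    abel
  rw [e1, e2]

lemma F_ineq (L : Submodule ℤ (EuclideanSpace ℝ (Fin n))) [DiscreteTopology L]
    [IsZLattice ℝ L] (s : ℝ) (hs : 0 < s) (t : EuclideanSpace ℝ (Fin n)) :
    2 * (F L s t * F L s t) ≤ F L s (t + t) * F L s 0 + F L s 0 * F L s 0 := by
  have h2 : Function.Injective (fun w : L => w + w) := fun x y hxy => by
    have h : (x : EuclideanSpace ℝ (Fin n)) + x = y + y := by
      exact_mod_cast congrArg Subtype.val hxy
    rw [← two_smul ℝ, ← two_smul ℝ (y : EuclideanSpace ℝ (Fin n))] at h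
    exact Subtype.ext (smul_right_injective _ (two_ne_zero (α := ℝ)) h)
  obtain ⟨Q, π, hQ⟩ := unfold_sum h2
  let K (x : EuclideanSpace ℝ (Fin n)) (p : L) : ℝ≥0∞ :=
    ENNReal.ofReal (k s ((p : EuclideanSpace ℝ (Fin n)) + x))
  have key : ∀ x y, ENNReal.ofReal (F L s x) * ENNReal.ofReal (F L s y) =
      ∑' c, (∑' p, (π ⁻¹' {c}).indicator (K (x + y)) p) *
        (∑' p, (π ⁻¹' {c}).indicator (K (x - y)) p) := fun x y => by
    rw [F_mul L s hs, ← hQ]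
  have e1 := key t t
  have e2 := key (t + t) 0
  have e3 := key 0 0
  rw [sub_self] at e1
  rw [add_zero, sub_zero] at e2
  rw [add_zero, sub_zero] at e3
  have hE : 2 * (ENNReal.ofReal (F L s t) * ENNReal.ofReal (F L s t)) ≤
      ENNReal.ofReal (F L s (t + t)) * ENNReal.ofReal (F L s 0) +
        ENNReal.ofReal (F L s 0) * ENNReal.ofReal (F L s 0) := by
    rw [e1, e2, e3, ← ENNReal.tsum_mul_left, ← ENNReal.tsum_add]
    exact ENNReal.tsum_le_tsum fun c => amgm _ _
  have n0 := F_nonneg L s 0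
  have n1 := F_nonneg L s t
  have n2 := F_nonneg L s (t + t)
  rw [← ENNReal.ofReal_mul n1, ← ENNReal.ofReal_mul n2, ← ENNReal.ofReal_mul n0,
    ← ENNReal.ofReal_add (by positivity) (by positivity),
    two_mul, ← ENNReal.ofReal_add (by positivity) (by positivity), ← two_mul] at hE
  exact (ENNReal.ofReal_le_ofReal_iff (by positivity)).mp hE

lemma F_le (L : Submodule ℤ (EuclideanSpace ℝ (Fin n))) [DiscreteTopology L]
    [IsZLattice ℝ L] (s : ℝ) (hs : 0 < s) (t : EuclideanSpace ℝ (Fin n)) :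
    F L s t ≤ F L s 0 := by
  obtain ⟨C, hC⟩ := F_bdd L s hs
  have hbdd : BddAbove (Set.range (F L s)) := ⟨C, by rintro _ ⟨t, rfl⟩; exact hC t⟩
  set M := ⨆ t, F L s t with hM
  have hle : ∀ t, F L s t ≤ M := fun t => le_ciSup hbdd t
  have n0 := F_nonneg L s 0
  have hM0 : 0 ≤ M := n0.trans (hle 0)
  have h1 : M ≤ √((M * F L s 0 + F L s 0 * F L s 0) / 2) := by
    refine ciSup_le fun t => Real.le_sqrt_of_sq_le ?_
    have h := F_ineq L s hs t
    have := mul_le_mul_of_nonneg_right (hle (t + t)) n0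
    nlinarith
  have h2 : M ^ 2 ≤ (M * F L s 0 + F L s 0 * F L s 0) / 2 :=
    (Real.le_sqrt hM0 (by positivity)).mp h1
  have h3 : M ≤ F L s 0 := by
    by_contra! hlt
    nlinarith
  exact (hle t).trans h3

end RhoAux

/-- The Gaussian mass of any coset is at most that of the lattice:
`ρ_s(L + t) ≤ ρ_s(L)`. -/
theorem rho_coset_le_rho_lattice (n : ℕ)
    (L : Submodule ℤ (EuclideanSpace ℝ (Fin n))) [DiscreteTopology L] [IsZLattice ℝ L]
    (s : ℝ) (hs : 0 < s) (t : EuclideanSpace ℝ (Fin n)) :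
    rhoSet s (coset L t) ≤ rhoSet s (L : Set (EuclideanSpace ℝ (Fin n))) := by
  have h1 : rhoSet s (coset L t) = RhoAux.F L s t := by
    unfold rhoSet coset
    rw [tsum_image (rho s) (add_left_injective t).injOn]
    rfl
  have h2 : rhoSet s (L : Set (EuclideanSpace ℝ (Fin n))) = RhoAux.F L s 0 := by
    unfold rhoSet RhoAux.F
    simp only [add_zero]
    rfl
  rw [h1, h2]
  exact RhoAux.F_le L s hs t
end

section
/- Let L be a full-rank lattice in ℝ^n, s > 0, and x ∈ ℝ^n, and let r_x = dist(x, L). Then ρ_s(L + x) ≥ ρ_s(L) · e^{−π r_x²/s²}; equivalently, ρ_s(L + x)/ρ_s(L) ≥ ρ_s(r_x). -/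
open MeasureTheory

/-- The Gaussian function evaluated at a real radius: `ρ_s(r) = exp(-π r²/s²)`. -/
noncomputable def rhoR (s r : ℝ) : ℝ :=
  Real.exp (-Real.pi * r ^ 2 / s ^ 2)

lemma rho_summable {n : ℕ} (L : Submodule ℤ (EuclideanSpace ℝ (Fin n))) [DiscreteTopology L]
    (s : ℝ) (hs : 0 < s) (t : EuclideanSpace ℝ (Fin n)) :
    Summable fun v : L => rho s ((v : EuclideanSpace ℝ (Fin n)) + t) := by
  set k := Module.finrank ℤ L + 1 with hk
  have h1 := ZLattice.summable_norm_sub_inv_pow L (2 * k) (by omega) (-t)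
  have ha : 0 < Real.pi / s ^ 2 := by positivity
  set a := Real.pi / s ^ 2 with ha'
  refine Summable.of_norm_bounded_eventually (h1.mul_left ((k.factorial : ℝ) / a ^ k)) ?_
  rw [Filter.eventually_cofinite]
  refine Set.Subsingleton.finite ?_
  have key : ∀ v : L, (v : EuclideanSpace ℝ (Fin n)) + t ≠ 0 →
      ‖rho s ((v : EuclideanSpace ℝ (Fin n)) + t)‖ ≤ (k.factorial : ℝ) / a ^ k *
        ‖(v : EuclideanSpace ℝ (Fin n)) - -t‖⁻¹ ^ (2 * k) := by
    intro v hv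
    rw [sub_neg_eq_add]
    have hy : 0 < ‖(v : EuclideanSpace ℝ (Fin n)) + t‖ := norm_pos_iff.mpr hv
    unfold rho
    rw [Real.norm_eq_abs, Real.abs_exp]
    set y := ‖(v : EuclideanSpace ℝ (Fin n)) + t‖
    have e1 : -Real.pi * y ^ 2 / s ^ 2 = -(a * y ^ 2) := by rw [ha']; ring
    have h2 := Real.pow_div_factorial_le_exp (x := a * y ^ 2) (by positivity) k
    rw [e1, Real.exp_neg]
    have h3 : (k.factorial : ℝ) / a ^ k * y⁻¹ ^ (2 * k) = ((a * y ^ 2) ^ k / k.factorial)⁻¹ := by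
      rw [mul_pow, ← pow_mul, inv_div, inv_pow]
      field_simp
    rw [h3]
    exact inv_anti₀ (by positivity) h2
  intro v hv w hw
  have hv' : (v : EuclideanSpace ℝ (Fin n)) + t = 0 := by
    by_contra h
    exact hv (key v h)
  have hw' : (w : EuclideanSpace ℝ (Fin n)) + t = 0 := by
    by_contra h
    exact hw (key w h)
  exact Subtype.ext (add_right_cancel (hv'.trans hw'.symm))

lemma rhoSet_coset_eq {n : ℕ} (L : Submodule ℤ (EuclideanSpace ℝ (Fin n)))
    (s : ℝ) (t : EuclideanSpace ℝ (Fin n)) :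
    rhoSet s (coset L t) = ∑' v : L, rho s ((v : EuclideanSpace ℝ (Fin n)) + t) := by
  unfold rhoSet coset
  exact tsum_image (rho s) ((add_left_injective t).injOn)

lemma rho_pair {n : ℕ} (s : ℝ) (v t : EuclideanSpace ℝ (Fin n)) :
    2 * (rho s v * rho s t) ≤ rho s (v + t) + rho s (-v + t) := by
  unfold rho
  have hp := parallelogram_law_with_norm ℝ t v
  have e1 : v + t = t + v := add_comm _ _
  have e2 : -v + t = t - v := by abel
  rw [e1, e2, ← Real.exp_add]
  set A := -Real.pi * ‖t + v‖ ^ 2 / s ^ 2 with hA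
  set B := -Real.pi * ‖t - v‖ ^ 2 / s ^ 2 with hB
  have e3 : -Real.pi * ‖v‖ ^ 2 / s ^ 2 + -Real.pi * ‖t‖ ^ 2 / s ^ 2 = A / 2 + B / 2 := by
    rw [hA, hB]
    linear_combination (Real.pi / s ^ 2 / 2) * hp
  rw [e3, Real.exp_add]
  have hA2 : Real.exp A = Real.exp (A / 2) ^ 2 := by
    rw [← Real.exp_nat_mul]; congr 1; push_cast; ring
  have hB2 : Real.exp B = Real.exp (B / 2) ^ 2 := by
    rw [← Real.exp_nat_mul]; congr 1; push_cast; ring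
  rw [hA2, hB2]
  nlinarith [sq_nonneg (Real.exp (A / 2) - Real.exp (B / 2))]

lemma rho_sum_ge {n : ℕ} (L : Submodule ℤ (EuclideanSpace ℝ (Fin n))) [DiscreteTopology L]
    (s : ℝ) (hs : 0 < s) (t : EuclideanSpace ℝ (Fin n)) :
    (∑' v : L, rho s (v : EuclideanSpace ℝ (Fin n))) * rho s t ≤
      ∑' v : L, rho s ((v : EuclideanSpace ℝ (Fin n)) + t) := by
  have h0 : Summable fun v : L => rho s (v : EuclideanSpace ℝ (Fin n)) := by
    simpa using rho_summable L s hs 0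
  have h1 := rho_summable L s hs t
  have h2 : Summable fun v : L => rho s (-(v : EuclideanSpace ℝ (Fin n)) + t) :=
    (Equiv.neg L).summable_iff.mpr h1
  have e2 : ∑' v : L, rho s (-(v : EuclideanSpace ℝ (Fin n)) + t) =
      ∑' v : L, rho s ((v : EuclideanSpace ℝ (Fin n)) + t) :=
    (Equiv.neg L).tsum_eq (fun v : L => rho s ((v : EuclideanSpace ℝ (Fin n)) + t))
  have h3 := Summable.tsum_le_tsum (fun v : L => rho_pair s (v : EuclideanSpace ℝ (Fin n)) t)
    ((h0.mul_right (rho s t)).mul_left 2) (h1.add h2)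
  rw [h1.tsum_add h2, e2, tsum_mul_left, tsum_mul_right] at h3
  linarith

/-- Lower bound: `ρ_s(L + x) ≥ ρ_s(L) · e^{-π r_x²/s²}` where `r_x = dist(x, L)`. -/
theorem rho_coset_ge (n : ℕ)
    (L : Submodule ℤ (EuclideanSpace ℝ (Fin n))) [DiscreteTopology L] [IsZLattice ℝ L]
    (s : ℝ) (hs : 0 < s) (x : EuclideanSpace ℝ (Fin n)) (rx : ℝ)
    (hrx : rx = Metric.infDist x (L : Set (EuclideanSpace ℝ (Fin n)))) :
    rhoSet s (coset L x) ≥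
      rhoSet s (L : Set (EuclideanSpace ℝ (Fin n))) * rhoR s rx := by
  have hcl : IsClosed (L : Set (EuclideanSpace ℝ (Fin n))) :=
    @AddSubgroup.isClosed_of_discrete _ _ _ _ _ L.toAddSubgroup
      (inferInstanceAs (DiscreteTopology L))
  obtain ⟨w, hw, hd⟩ := hcl.exists_infDist_eq_dist ⟨0, L.zero_mem⟩ x
  have hr : rhoR s rx = rho s (x - w) := by
    unfold rhoR rho
    rw [hrx, hd, dist_eq_norm]
  have e : ∑' v : L, rho s ((v : EuclideanSpace ℝ (Fin n)) + (x - w)) =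
      ∑' v : L, rho s ((v : EuclideanSpace ℝ (Fin n)) + x) := by
    rw [← (Equiv.subRight (⟨w, hw⟩ : L)).tsum_eq
      (fun v : L => rho s ((v : EuclideanSpace ℝ (Fin n)) + x))]
    refine tsum_congr fun v => ?_
    congr 1
    simp only [Equiv.subRight_apply, Submodule.coe_sub]
    abel
  rw [rhoSet_coset_eq, hr, ← e]
  exact rho_sum_ge L s hs (x - w)
end

section
/- (Distinguishing inequality, upper bound.) Let L be a full-rank lattice in ℝ^n, s > 0, and x ∈ ℝ^n. Let τ = s·√(n/(2π)) and r_x = dist(x, L). If r_x ≥ τ, then ρ_s(L + x)/ρ_s(L) ≤ (r_x/τ)^n · e^{n/2} · ρ_s(r_x). -/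
open MeasureTheory

open scoped ENNReal

/-- The Gaussian as an extended nonnegative real. -/
noncomputable def gE {n : ℕ} (s : ℝ) (x : EuclideanSpace ℝ (Fin n)) : ℝ≥0∞ :=
  ENNReal.ofReal (rho s x)

/-- The periodization of the Gaussian. -/
noncomputable def HE {n : ℕ} (L : Submodule ℤ (EuclideanSpace ℝ (Fin n))) (s : ℝ)
    (x : EuclideanSpace ℝ (Fin n)) : ℝ≥0∞ :=
  ∑' v : L, gE s ((v : EuclideanSpace ℝ (Fin n)) + x)

lemma gE_meas {n : ℕ} (s : ℝ) : Measurable (gE (n := n) s) := by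
  unfold gE rho
  fun_prop

lemma gE_neg {n : ℕ} (s : ℝ) (x : EuclideanSpace ℝ (Fin n)) : gE s (-x) = gE s x := by
  simp [gE, rho]

lemma lintegral_gE {n : ℕ} (c : ℝ) (hc : 0 < c) :
    ∫⁻ y : EuclideanSpace ℝ (Fin n), gE c y = ENNReal.ofReal (c ^ n) := by
  have hb : 0 < Real.pi / c ^ 2 := by positivity
  have hI := GaussianFourier.integral_rexp_neg_mul_sq_norm (V := EuclideanSpace ℝ (Fin n)) hb
  have e : ∀ y : EuclideanSpace ℝ (Fin n),
      Real.exp (-(Real.pi / c ^ 2) * ‖y‖ ^ 2) = rho c y := by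
    intro y; unfold rho; congr 1; ring
  simp only [e] at hI
  have hv : (Real.pi / (Real.pi / c ^ 2)) ^
      ((Module.finrank ℝ (EuclideanSpace ℝ (Fin n)) : ℝ) / 2) = c ^ n := by
    have : Real.pi / (Real.pi / c ^ 2) = c ^ 2 := by
      have := Real.pi_pos
      field_simp
    rw [this, finrank_euclideanSpace_fin, ← Real.rpow_natCast c 2, ← Real.rpow_mul hc.le,
      ← Real.rpow_natCast c n]
    congr 1
    push_cast; ring
  rw [hv] at hI
  have hint : Integrable (fun y : EuclideanSpace ℝ (Fin n) => rho c y) := by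
    by_contra h
    rw [integral_undef h] at hI
    exact (pow_pos hc n).ne hI
  rw [← hI, ofReal_integral_eq_lintegral_ofReal hint]
  · rfl
  · exact Filter.Eventually.of_forall fun y => (Real.exp_pos _).le

lemma conv_gE {n : ℕ} (a b c d : ℝ) (ha : 0 < a) (hb : 0 < b) (hc : 0 < c) (hd : 0 < d)
    (h1 : d ^ 2 = a ^ 2 + b ^ 2) (h2 : c * d = a * b) (x : EuclideanSpace ℝ (Fin n)) :
    ∫⁻ y, gE a y * gE b (x - y) = ENNReal.ofReal (c ^ n) * gE d x := by
  have key : ∀ y : EuclideanSpace ℝ (Fin n),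
      gE a y * gE b (x - y) = gE d x * gE c (y - (a ^ 2 / d ^ 2) • x) := by
    intro y
    unfold gE rho
    rw [← ENNReal.ofReal_mul (Real.exp_pos _).le, ← ENNReal.ofReal_mul (Real.exp_pos _).le,
      ← Real.exp_add, ← Real.exp_add]
    congr 2
    rw [norm_sub_sq_real, norm_sub_sq_real, inner_smul_right, norm_smul, mul_pow,
      real_inner_comm y x, Real.norm_eq_abs, sq_abs]
    have hc2 : c ^ 2 = a ^ 2 * b ^ 2 / d ^ 2 := by
      field_simp
      rw [← mul_pow, h2]; ring
    rw [hc2, h1]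
    have : a ^ 2 + b ^ 2 ≠ 0 := by positivity
    generalize ‖x‖ = X
    generalize ‖y‖ = Y
    field_simp
    ring
  simp only [key]
  have hm := gE_meas (n := n) c
  rw [lintegral_const_mul _ (by fun_prop),
    lintegral_sub_right_eq_self (fun y => gE c y), lintegral_gE c hc, mul_comm]

section lattice

variable {n : ℕ} (L : Submodule ℤ (EuclideanSpace ℝ (Fin n)))

lemma HE_periodic (s : ℝ) (w : L) (x : EuclideanSpace ℝ (Fin n)) :
    HE L s ((w : EuclideanSpace ℝ (Fin n)) + x) = HE L s x := by
  unfold HE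
  rw [← (Equiv.addRight w).tsum_eq (fun v : L => gE s ((v : EuclideanSpace ℝ (Fin n)) + x))]
  refine tsum_congr fun v => ?_
  simp [add_assoc]

lemma HE_neg (s : ℝ) (x : EuclideanSpace ℝ (Fin n)) : HE L s (-x) = HE L s x := by
  unfold HE
  rw [← (Equiv.neg L).tsum_eq]
  refine tsum_congr fun v => ?_
  rw [← gE_neg]
  simp [add_comm]

variable [DiscreteTopology L] [IsZLattice ℝ L]

lemma HE_meas (s : ℝ) : Measurable (HE L s) := by
  unfold HE
  exact Measurable.tsum fun v => (gE_meas s).comp (measurable_id.const_add _)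

lemma conv_HE (a b c d : ℝ) (ha : 0 < a) (hb : 0 < b) (hc : 0 < c) (hd : 0 < d)
    (h1 : d ^ 2 = a ^ 2 + b ^ 2) (h2 : c * d = a * b) (x : EuclideanSpace ℝ (Fin n)) :
    ∫⁻ y, gE a y * HE L b (x - y) = ENNReal.ofReal (c ^ n) * HE L d x := by
  unfold HE
  simp only [← ENNReal.tsum_mul_left]
  rw [lintegral_tsum]
  · refine tsum_congr fun v => ?_
    rw [← conv_gE a b c d ha hb hc hd h1 h2]
    simp only [add_sub_assoc]
  · intro v
    have := gE_meas (n := n) a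
    have := gE_meas (n := n) b
    fun_prop

lemma unfold_HE : ∃ F : Set (EuclideanSpace ℝ (Fin n)), ∀ (a : ℝ) (z : EuclideanSpace ℝ (Fin n))
    (p : EuclideanSpace ℝ (Fin n) → ℝ≥0∞) (_ : Measurable p)
    (_ : ∀ (v : L) y, p ((v : EuclideanSpace ℝ (Fin n)) + y) = p y),
    ∫⁻ y, gE a (y - z) * p y = ∫⁻ y in F, HE L a (y - z) * p y := by
  have hF := ZLattice.isAddFundamentalDomain (Module.Free.chooseBasis ℤ L)
    (volume : Measure (EuclideanSpace ℝ (Fin n)))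
  refine ⟨ZSpan.fundamentalDomain (Module.Basis.ofZLatticeBasis ℝ L (Module.Free.chooseBasis ℤ L)),
    fun a z p hp hper => ?_⟩
  · haveI : VAddInvariantMeasure L (EuclideanSpace ℝ (Fin n)) volume :=
      inferInstanceAs <| VAddInvariantMeasure L.toAddSubgroup (EuclideanSpace ℝ (Fin n)) volume
    haveI : MeasurableConstVAdd L (EuclideanSpace ℝ (Fin n)) :=
      inferInstanceAs <| MeasurableConstVAdd L.toAddSubgroup (EuclideanSpace ℝ (Fin n))
    rw [hF.lintegral_eq_tsum'' (fun y => gE a (y - z) * p y)]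
    unfold HE
    simp only [← ENNReal.tsum_mul_right]
    rw [lintegral_tsum]
    · refine tsum_congr fun v => ?_
      refine lintegral_congr fun y => ?_
      have : v +ᵥ y = (v : EuclideanSpace ℝ (Fin n)) + y := rfl
      rw [this, hper, add_sub_assoc]
    · intro v
      have := gE_meas (n := n) a
      fun_prop

lemma two_mul_le_sq_add (a b : ℝ≥0∞) : 2 * (a * b) ≤ a * a + b * b := by
  wlog h : a ≤ b generalizing a b
  · rw [mul_comm a b, add_comm]; exact this b a (le_of_not_ge h)
  obtain ⟨c, rfl⟩ := exists_add_of_le h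
  have : a * a + (a + c) * (a + c) = 2 * (a * (a + c)) + c * c := by ring
  rw [this]; exact le_self_add

lemma HE_le (s : ℝ) (hs : 0 < s) (x : EuclideanSpace ℝ (Fin n)) : HE L s x ≤ HE L s 0 := by
  obtain ⟨F, hF⟩ := unfold_HE L
  have h2 : (0 : ℝ) < Real.sqrt 2 := by positivity
  have hsq : Real.sqrt 2 ^ 2 = 2 := Real.sq_sqrt (by norm_num)
  set a := s / Real.sqrt 2 with ha
  have hapos : 0 < a := by positivity
  have ha2 : s ^ 2 = a ^ 2 + a ^ 2 := by
    rw [ha, div_pow, hsq]; ring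
  have hm := HE_meas L a
  have e : ∀ x, ENNReal.ofReal ((s / 2) ^ n) * HE L s x = ∫⁻ y in F, HE L a y * HE L a (y - x) := by
    intro x
    rw [← conv_HE L a a (s / 2) s hapos hapos (by positivity) hs ha2 (by nlinarith) x]
    have := hF a 0 (fun y => HE L a (y - x)) (by fun_prop)
      (fun v y => by rw [add_sub_assoc, HE_periodic])
    simp only [sub_zero] at this
    rw [← this]
    refine lintegral_congr fun y => ?_
    rw [← HE_neg L a (y - x), neg_sub]
  have e2 : ∫⁻ y in F, HE L a (y - x) * HE L a (y - x) = ∫⁻ y in F, HE L a y * HE L a y := by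
    rw [← hF a x (fun y => HE L a (y - x)) (by fun_prop)
      (fun v y => by rw [add_sub_assoc, HE_periodic])]
    have := hF a 0 (fun y => HE L a y) (by fun_prop) (fun v y => by rw [HE_periodic])
    simp only [sub_zero] at this
    rw [← this, lintegral_sub_right_eq_self (fun y => gE a y * HE L a y)]
  have e3 : 2 * (ENNReal.ofReal ((s / 2) ^ n) * HE L s x) ≤
      2 * (ENNReal.ofReal ((s / 2) ^ n) * HE L s 0) := by
    rw [e, e, ← lintegral_const_mul _ (by fun_prop)]
    calc _ ≤ ∫⁻ y in F, (HE L a y * HE L a y + HE L a (y - x) * HE L a (y - x)) :=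
          lintegral_mono fun y => two_mul_le_sq_add _ _
      _ = _ := by
        rw [lintegral_add_left (by fun_prop), e2]
        simp only [sub_zero]
        rw [two_mul]
  have k0 : ENNReal.ofReal ((s / 2) ^ n) ≠ 0 := by
    rw [Ne, ENNReal.ofReal_eq_zero, not_le]; positivity
  rw [ENNReal.mul_le_mul_iff_right (by norm_num) (by norm_num),
    ENNReal.mul_le_mul_iff_right k0 ENNReal.ofReal_ne_top] at e3
  exact e3

lemma HE_scale (s t : ℝ) (hs : 0 < s) (ht : 1 ≤ t) (x : EuclideanSpace ℝ (Fin n)) :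
    HE L (t * s) x ≤ ENNReal.ofReal (t ^ n) * HE L s 0 := by
  rcases ht.eq_or_lt with rfl | ht
  · simpa using HE_le L s hs x
  have hp : 0 < t ^ 2 - 1 := by nlinarith
  have hq : 0 < Real.sqrt (t ^ 2 - 1) := Real.sqrt_pos.2 hp
  have hqq : Real.sqrt (t ^ 2 - 1) ^ 2 = t ^ 2 - 1 := Real.sq_sqrt hp.le
  set q := Real.sqrt (t ^ 2 - 1)
  have ht0 : 0 < t := by linarith
  have hc : 0 < q * s / t := by positivity
  have e := conv_HE L (q * s) s (q * s / t) (t * s) (by positivity) hs hc (by positivity)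
    (by rw [mul_pow, mul_pow, hqq]; ring) (by field_simp) x
  have k0 : ENNReal.ofReal ((q * s / t) ^ n) ≠ 0 := by
    rw [Ne, ENNReal.ofReal_eq_zero, not_le]; positivity
  rw [← ENNReal.mul_le_mul_iff_right k0 ENNReal.ofReal_ne_top, ← e, ← mul_assoc,
    ← ENNReal.ofReal_mul (by positivity), ← mul_pow]
  have : q * s / t * t = q * s := by field_simp
  rw [this, ← lintegral_gE (q * s) (by positivity), ← lintegral_mul_const _ (gE_meas _)]
  exact lintegral_mono fun y => mul_le_mul_right (HE_le L s hs _) _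

end lattice

lemma HE_toReal {n : ℕ} (L : Submodule ℤ (EuclideanSpace ℝ (Fin n))) (s : ℝ)
    (x : EuclideanSpace ℝ (Fin n)) : (HE L s x).toReal = rhoSet s (coset L x) := by
  unfold HE rhoSet coset gE
  rw [ENNReal.tsum_toReal_eq fun _ => ENNReal.ofReal_ne_top,
    tsum_image (rho s) (add_left_injective x).injOn]
  refine tsum_congr fun v => ENNReal.toReal_ofReal (Real.exp_pos _).le

/-- Distinguishing inequality, upper bound: if `r_x ≥ τ = s√(n/2π)` then
`ρ_s(L + x)/ρ_s(L) ≤ (r_x/τ)ⁿ · e^{n/2} · ρ_s(r_x)`. -/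
theorem distinguishing_upper (n : ℕ)
    (L : Submodule ℤ (EuclideanSpace ℝ (Fin n))) [DiscreteTopology L] [IsZLattice ℝ L]
    (s : ℝ) (hs : 0 < s) (x : EuclideanSpace ℝ (Fin n)) (τ rx : ℝ)
    (hτ : τ = s * Real.sqrt (n / (2 * Real.pi)))
    (hrx : rx = Metric.infDist x (L : Set (EuclideanSpace ℝ (Fin n))))
    (hr : τ ≤ rx) :
    rhoSet s (coset L x) / rhoSet s (L : Set (EuclideanSpace ℝ (Fin n))) ≤
      (rx / τ) ^ n * Real.exp ((n : ℝ) / 2) * rhoR s rx := by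
  have hpi := Real.pi_pos
  have h0 : (L : Set (EuclideanSpace ℝ (Fin n))) = coset L 0 := by simp [coset]
  have hτ0 : 0 ≤ τ := by rw [hτ]; positivity
  have hrx0 : 0 ≤ rx := hτ0.trans hr
  set K := (rx / τ) ^ n * Real.exp ((n : ℝ) / 2) * rhoR s rx with hK
  have hK0 : 0 ≤ K := by
    unfold rhoR at hK
    rw [hK]; positivity
  have main : HE L s x ≤ ENNReal.ofReal K * HE L s 0 := by
    rcases Nat.eq_zero_or_pos n with rfl | hn
    · have hx : x = 0 := Subsingleton.elim _ _
      have : rx = 0 := by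
        rw [hrx, hx]; exact Metric.infDist_zero_of_mem L.zero_mem
      have : K = 1 := by simp [hK, rhoR, this]
      rw [this, hx]; simp
    have hn' : (0 : ℝ) < n := by exact_mod_cast hn
    have hτp : 0 < τ := by rw [hτ]; positivity
    have hτ2 : τ ^ 2 = s ^ 2 * (n / (2 * Real.pi)) := by
      rw [hτ, mul_pow, Real.sq_sqrt (by positivity)]
    have hrp : 0 < rx := hτp.trans_le hr
    set t := rx / τ with htdef
    have ht : 1 ≤ t := by rw [htdef, le_div_iff₀ hτp]; linarith
    have htp : 0 < t := by linarith
    have hrt : rx = t * τ := by rw [htdef]; field_simp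
    have step : HE L s x ≤
        ENNReal.ofReal (Real.exp ((n : ℝ) / 2) * rhoR s rx) * HE L (t * s) x := by
      unfold HE
      rw [← ENNReal.tsum_mul_left]
      refine ENNReal.tsum_le_tsum fun v => ?_
      unfold gE rho rhoR
      rw [← Real.exp_add, ← ENNReal.ofReal_mul (Real.exp_pos _).le, ← Real.exp_add]
      refine ENNReal.ofReal_le_ofReal (Real.exp_le_exp.2 ?_)
      have hd : rx ≤ ‖(v : EuclideanSpace ℝ (Fin n)) + x‖ := by
        rw [hrx]
        refine (Metric.infDist_le_dist_of_mem (L.neg_mem v.2)).trans_eq ?_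
        rw [dist_eq_norm, sub_neg_eq_add, add_comm]
      have hd2 : rx ^ 2 ≤ ‖(v : EuclideanSpace ℝ (Fin n)) + x‖ ^ 2 := by gcongr
      generalize ‖(v : EuclideanSpace ℝ (Fin n)) + x‖ = N at hd2
      have hn2 : (n : ℝ) / 2 = Real.pi * rx ^ 2 / (t * s) ^ 2 := by
        rw [hrt, mul_pow, mul_pow, hτ2]; field_simp
      rw [hn2]
      have h3 : 0 ≤ (N ^ 2 - rx ^ 2) * (Real.pi / s ^ 2 - Real.pi / (t * s) ^ 2) := by
        apply mul_nonneg (by linarith)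
        have : Real.pi / (t * s) ^ 2 ≤ Real.pi / s ^ 2 := by
          gcongr
          nlinarith
        linarith
      have h4 : Real.pi * rx ^ 2 / (t * s) ^ 2 + -Real.pi * rx ^ 2 / s ^ 2
          + -Real.pi * N ^ 2 / (t * s) ^ 2 - (-Real.pi * N ^ 2 / s ^ 2)
          = (N ^ 2 - rx ^ 2) * (Real.pi / s ^ 2 - Real.pi / (t * s) ^ 2) := by ring
      linarith
    refine step.trans ((mul_le_mul_right (HE_scale L s t hs ht x) _).trans_eq ?_)
    rw [← mul_assoc, ← ENNReal.ofReal_mul (by unfold rhoR; positivity), hK]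
    congr 2; ring
  rw [h0, ← HE_toReal, ← HE_toReal]
  by_cases htop : HE L s 0 = ⊤
  · simpa [htop] using hK0
  refine div_le_of_le_mul₀ ENNReal.toReal_nonneg hK0 ?_
  have := ENNReal.toReal_mono (ENNReal.mul_ne_top ENNReal.ofReal_ne_top htop) main
  rwa [ENNReal.toReal_mul, ENNReal.toReal_ofReal hK0] at this
end

section
/- (Improved distinguishing inequality.) Let L be a full-rank lattice in ℝ^n with n ≥ 500, let s > 0 and x ∈ ℝ^n, and let r_x = dist(x, L). Let c ≥ 1 and k ≥ 1.04. If r_x ≥ c·s·√(n/(2π)) and λ_1(L) ≥ k·c·s·√(n/(2π)), then ρ_s(r_x) ≤ ρ_s(L + x)/ρ_s(L) ≤ 2·(e^{1−c²})^{n/2}. -/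
open MeasureTheory

/-- `λ₁(L)`, the length of a shortest nonzero vector of `L`. -/
noncomputable def lambdaOne {n : ℕ} (L : Submodule ℤ (EuclideanSpace ℝ (Fin n))) : ℝ :=
  sInf {r : ℝ | ∃ v : EuclideanSpace ℝ (Fin n), v ∈ L ∧ v ≠ 0 ∧ ‖v‖ = r}

open scoped ENNReal

/-- The Gaussian with parameter `b`, with values in `ℝ≥0∞`. -/
noncomputable def gG {n : ℕ} (b : ℝ) (z : EuclideanSpace ℝ (Fin n)) : ℝ≥0∞ :=
  ENNReal.ofReal (Real.exp (-b * ‖z‖ ^ 2))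

/-- The Gaussian mass of `L + x`, with values in `ℝ≥0∞`. -/
noncomputable def gF {n : ℕ} (L : Submodule ℤ (EuclideanSpace ℝ (Fin n))) (b : ℝ)
    (x : EuclideanSpace ℝ (Fin n)) : ℝ≥0∞ :=
  ∑' v : L, gG b ((v : EuclideanSpace ℝ (Fin n)) + x)

lemma gG_meas {n : ℕ} (b : ℝ) : Measurable (gG (n := n) b) := by
  unfold gG; fun_prop

lemma gG_int {n : ℕ} {a : ℝ} (ha : 0 < a) :
    ∫⁻ y : EuclideanSpace ℝ (Fin n), gG a y = ENNReal.ofReal ((Real.pi / a) ^ ((n : ℝ) / 2)) := by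
  have h := GaussianFourier.integral_rexp_neg_mul_sq_norm (V := EuclideanSpace ℝ (Fin n)) ha
  have hpos : 0 < (Real.pi / a) ^ ((n : ℝ) / 2) := by positivity
  simp only [finrank_euclideanSpace, Fintype.card_fin] at h
  have hi : Integrable (fun v : EuclideanSpace ℝ (Fin n) => Real.exp (-a * ‖v‖ ^ 2)) := by
    by_contra hc
    rw [integral_undef hc] at h
    linarith
  unfold gG
  rw [← ofReal_integral_eq_lintegral_ofReal hi (Filter.Eventually.of_forall fun _ => by positivity), h]

lemma gG_conv {n : ℕ} {b d : ℝ} (hb : 0 < b) (hd : 0 < d) (z : EuclideanSpace ℝ (Fin n)) :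
    ∫⁻ y : EuclideanSpace ℝ (Fin n), gG d y * gG b (z + y) =
      ENNReal.ofReal ((Real.pi / (b + d)) ^ ((n : ℝ) / 2)) * gG (b * d / (b + d)) z := by
  have h : ∀ y : EuclideanSpace ℝ (Fin n), gG d y * gG b (z + y) =
      gG (b + d) (y + (b / (b + d)) • z) * gG (b * d / (b + d)) z := by
    intro y
    unfold gG
    rw [← ENNReal.ofReal_mul (by positivity), ← ENNReal.ofReal_mul (by positivity),
      ← Real.exp_add, ← Real.exp_add]
    congr 2
    rw [norm_add_sq_real, norm_add_sq_real, norm_smul, inner_smul_right, real_inner_comm,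
      Real.norm_of_nonneg (by positivity)]
    field_simp
    ring
  simp_rw [h]
  have hm : Measurable fun y : EuclideanSpace ℝ (Fin n) => gG (b + d) (y + (b / (b + d)) • z) :=
    (gG_meas _).comp (measurable_add_const _)
  rw [lintegral_mul_const _ hm,
    lintegral_add_right_eq_self (gG (b + d)), gG_int (by positivity)]

section
variable {n : ℕ} (L : Submodule ℤ (EuclideanSpace ℝ (Fin n)))

lemma gF_add (b : ℝ) (v : L) (x : EuclideanSpace ℝ (Fin n)) :
    gF L b ((v : EuclideanSpace ℝ (Fin n)) + x) = gF L b x := by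
  unfold gF
  rw [← (Equiv.addRight v).tsum_eq (fun w : L => gG b ((w : EuclideanSpace ℝ (Fin n)) + x))]
  refine tsum_congr fun w => ?_
  simp [add_assoc]

lemma gF_lower {b : ℝ} (z : EuclideanSpace ℝ (Fin n)) :
    gG b z * gF L b 0 ≤ gF L b z := by
  have h : 2 * (gG b z * gF L b 0) ≤ 2 * gF L b z := by
    rw [two_mul (gF L b z)]
    have e : gF L b z = ∑' v : L, gG b (-(v : EuclideanSpace ℝ (Fin n)) + z) := by
      unfold gF
      rw [← (Equiv.neg L).tsum_eq]
      rfl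
    nth_rewrite 2 [e]
    unfold gF
    rw [← ENNReal.tsum_add, ← ENNReal.tsum_mul_left, ← ENNReal.tsum_mul_left]
    refine ENNReal.tsum_le_tsum fun v => ?_
    unfold gG
    rw [← ENNReal.ofReal_mul (by positivity), ← ENNReal.ofReal_add (by positivity) (by positivity),
      ← Real.exp_add]
    have e2 : ∀ r : ℝ, 2 * ENNReal.ofReal r = ENNReal.ofReal (2 * r) := by
      intro r
      rw [ENNReal.ofReal_mul (by norm_num)]
      simp
    rw [e2]
    apply ENNReal.ofReal_le_ofReal
    rw [norm_add_sq_real, norm_add_sq_real, norm_add_sq_real, norm_neg, inner_neg_left]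
    simp only [norm_zero, inner_zero_right]
    set i := inner ℝ (v : EuclideanSpace ℝ (Fin n)) z
    have hp := Real.exp_pos (-b * ‖z‖ ^ 2 + -b * ‖(v : EuclideanSpace ℝ (Fin n))‖ ^ 2)
    have h1 := Real.add_one_le_exp (-b * (2 * i))
    have h2 := Real.add_one_le_exp (b * (2 * i))
    rw [show -b * (‖(v : EuclideanSpace ℝ (Fin n))‖ ^ 2 + 2 * i + ‖z‖ ^ 2) =
      (-b * ‖z‖ ^ 2 + -b * ‖(v : EuclideanSpace ℝ (Fin n))‖ ^ 2) + -b * (2 * i) by ring,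
      show -b * (‖(v : EuclideanSpace ℝ (Fin n))‖ ^ 2 + 2 * -i + ‖z‖ ^ 2) =
      (-b * ‖z‖ ^ 2 + -b * ‖(v : EuclideanSpace ℝ (Fin n))‖ ^ 2) + b * (2 * i) by ring,
      Real.exp_add _ (-b * (2 * i)), Real.exp_add _ (b * (2 * i))]
    simp only [mul_zero, add_zero, ne_eq, OfNat.ofNat_ne_zero, not_false_eq_true, zero_pow]
    nlinarith
  rwa [ENNReal.mul_le_mul_iff_right (by simp) (by simp)] at h

variable [DiscreteTopology L] [IsZLattice ℝ L]

lemma gF_meas (b : ℝ) : Measurable (gF L b) := by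
  unfold gF
  exact Measurable.tsum fun v => (gG_meas b).comp (measurable_const_add _)

/-- Integrating a translate of `gF` against a Gaussian. -/
lemma gF_conv {b d : ℝ} (hb : 0 < b) (hd : 0 < d) (x : EuclideanSpace ℝ (Fin n)) :
    ∫⁻ y : EuclideanSpace ℝ (Fin n), gG d y * gF L b (y + x) =
      ENNReal.ofReal ((Real.pi / (b + d)) ^ ((n : ℝ) / 2)) * gF L (b * d / (b + d)) x := by
  unfold gF
  simp_rw [← ENNReal.tsum_mul_left]
  rw [lintegral_tsum]
  · refine tsum_congr fun v => ?_
    rw [← gG_conv hb hd]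
    refine lintegral_congr fun y => ?_
    rw [add_assoc, add_comm x y]
  · intro v
    exact ((gG_meas d).mul ((gG_meas b).comp
      ((measurable_id.add_const x).const_add _))).aemeasurable

lemma exists_fd : ∃ D : Set (EuclideanSpace ℝ (Fin n)), IsAddFundamentalDomain L D volume :=
  ⟨_, ZLattice.isAddFundamentalDomain (Module.Free.chooseBasis ℤ L) volume⟩

lemma unfold_fd {D : Set (EuclideanSpace ℝ (Fin n))} (hD : IsAddFundamentalDomain L D volume)
    (b : ℝ) (x z : EuclideanSpace ℝ (Fin n)) :
    ∫⁻ y in D, gF L b (y + x) * gF L b (y + z) =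
      ∫⁻ y, gG b (y + x) * gF L b (y + z) := by
  have : VAddInvariantMeasure L (EuclideanSpace ℝ (Fin n)) volume :=
    inferInstanceAs (VAddInvariantMeasure L.toAddSubgroup (EuclideanSpace ℝ (Fin n)) volume)
  have : MeasurableConstVAdd L (EuclideanSpace ℝ (Fin n)) :=
    inferInstanceAs (MeasurableConstVAdd L.toAddSubgroup (EuclideanSpace ℝ (Fin n)))
  rw [hD.lintegral_eq_tsum'', ← lintegral_tsum]
  · refine lintegral_congr fun y => ?_
    have : ∀ v : L, gG b ((v +ᵥ y) + x) * gF L b ((v +ᵥ y) + z) =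
        gG b ((v : EuclideanSpace ℝ (Fin n)) + (y + x)) * gF L b (y + z) := by
      intro v
      rw [← gF_add L b v (y + z), ← add_assoc, ← add_assoc]
      rw [Submodule.vadd_def, vadd_eq_add]
    simp_rw [this]
    rw [ENNReal.tsum_mul_right]
    rfl
  · intro v
    have h1 : Measurable fun y : EuclideanSpace ℝ (Fin n) => v +ᵥ y := measurable_const_vadd v
    exact (((gG_meas b).comp (h1.add_const x)).mul
      ((gF_meas L b).comp (h1.add_const z))).aemeasurable

lemma amgm (a c : ℝ≥0∞) : 2 * (a * c) ≤ a * a + c * c := by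
  rcases eq_or_ne a ⊤ with rfl | ha
  · simp
  rcases eq_or_ne c ⊤ with rfl | hc
  · simp
  lift a to NNReal using ha
  lift c to NNReal using hc
  norm_cast
  have := two_mul_le_add_sq (a : ℝ) c
  rw [← NNReal.coe_le_coe]
  push_cast
  nlinarith

lemma gF_le {b : ℝ} (hb : 0 < b) (x : EuclideanSpace ℝ (Fin n)) : gF L b x ≤ gF L b 0 := by
  obtain ⟨D, hD⟩ := exists_fd L
  have key : ∀ u : EuclideanSpace ℝ (Fin n), ∫⁻ y in D, gF L (2 * b) (y + 0) * gF L (2 * b) (y + u) =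
      ENNReal.ofReal ((Real.pi / (2 * b + 2 * b)) ^ ((n : ℝ) / 2)) * gF L b u := by
    intro u
    rw [unfold_fd L hD]
    simp_rw [add_zero]
    rw [gF_conv L (by positivity) (by positivity)]
    congr 2
    field_simp
    ring
  have h3 : ∫⁻ y in D, gF L (2 * b) (y + x) * gF L (2 * b) (y + x) =
      ∫⁻ y in D, gF L (2 * b) (y + 0) * gF L (2 * b) (y + 0) := by
    rw [unfold_fd L hD, unfold_fd L hD,
      lintegral_add_right_eq_self (fun y => gG (2 * b) y * gF L (2 * b) y)]
    simp
  have hm : ∀ u : EuclideanSpace ℝ (Fin n), Measurable fun y => gF L (2 * b) (y + u) :=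
    fun u => (gF_meas L _).comp (measurable_add_const u)
  have hm2 : ∀ u w : EuclideanSpace ℝ (Fin n), Measurable fun y =>
      gF L (2 * b) (y + u) * gF L (2 * b) (y + w) := fun u w => (hm u).mul (hm w)
  have h1 : 2 * ∫⁻ y in D, gF L (2 * b) (y + 0) * gF L (2 * b) (y + x) ≤
      2 * ∫⁻ y in D, gF L (2 * b) (y + 0) * gF L (2 * b) (y + 0) := by
    rw [two_mul (∫⁻ y in D, gF L (2 * b) (y + 0) * gF L (2 * b) (y + 0))]
    nth_rewrite 2 [← h3]
    rw [← lintegral_const_mul _ (hm2 0 x), ← lintegral_add_left (hm2 0 0)]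
    exact lintegral_mono fun y => amgm _ _
  rw [key, key] at h1
  have hK : 0 < (Real.pi / (2 * b + 2 * b)) ^ ((n : ℝ) / 2) := by positivity
  rw [ENNReal.mul_le_mul_iff_right (by simp) (by simp),
    ENNReal.mul_le_mul_iff_right (by simpa using hK) (by simp)] at h1
  exact h1

lemma gF_scale {b b' : ℝ} (hb' : 0 < b') (hbb : b' < b) :
    gF L b' 0 ≤ ENNReal.ofReal ((b / b') ^ ((n : ℝ) / 2)) * gF L b 0 := by
  have hb : 0 < b := hb'.trans hbb
  have hsub : 0 < b - b' := sub_pos.2 hbb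
  set d := b * b' / (b - b') with hd
  have hdpos : 0 < d := by positivity
  have h := gF_conv L hb hdpos 0
  have e1 : b * d / (b + d) = b' := by
    rw [hd]; field_simp; ring
  rw [e1] at h
  have h2 : ∫⁻ y : EuclideanSpace ℝ (Fin n), gG d y * gF L b (y + 0) ≤
      ENNReal.ofReal ((Real.pi / d) ^ ((n : ℝ) / 2)) * gF L b 0 := by
    rw [← gG_int hdpos, ← lintegral_mul_const _ (gG_meas d)]
    exact lintegral_mono fun y => by gcongr; exact gF_le L hb _
  rw [h] at h2
  have hK : 0 < (Real.pi / (b + d)) ^ ((n : ℝ) / 2) := by positivity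
  have e2 : (Real.pi / d) ^ ((n : ℝ) / 2) =
      (Real.pi / (b + d)) ^ ((n : ℝ) / 2) * (b / b') ^ ((n : ℝ) / 2) := by
    rw [← Real.mul_rpow (by positivity) (by positivity)]
    congr 1
    rw [hd]; field_simp; ring
  rw [e2, ENNReal.ofReal_mul hK.le, mul_assoc,
    ENNReal.mul_le_mul_iff_right (by simpa using hK) (by simp)] at h2
  exact h2

lemma gF_ne_top {b : ℝ} (hb : 0 < b) (x : EuclideanSpace ℝ (Fin n)) : gF L b x ≠ ⊤ := by
  refine ne_top_of_le_ne_top ?_ (gF_le L hb x)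
  classical
  set N := Module.finrank ℤ L + 1 with hN
  have hs := ZLattice.summable_norm_pow_inv L (2 * N) (by omega)
  have hs2 := (hs.mul_left ((N.factorial : ℝ) / b ^ N)).tsum_ofReal_ne_top
  have hle : gF L b 0 ≤ ∑' v : L, ((if v = 0 then 1 else 0) +
      ENNReal.ofReal ((N.factorial : ℝ) / b ^ N * ‖v‖⁻¹ ^ (2 * N))) := by
    refine ENNReal.tsum_le_tsum fun v => ?_
    by_cases hv : v = 0
    · subst hv
      simp [gG]
    · simp only [hv, if_false, zero_add, add_zero]
      unfold gG
      apply ENNReal.ofReal_le_ofReal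
      have hpos : 0 < ‖v‖ := norm_pos_iff.2 hv
      have h1 := Real.pow_div_factorial_le_exp (b * ‖v‖ ^ 2) (by positivity) N
      have h2 : (N.factorial : ℝ) / b ^ N * ‖v‖⁻¹ ^ (2 * N) =
          ((b * ‖v‖ ^ 2) ^ N / N.factorial)⁻¹ := by
        rw [pow_mul, mul_pow, inv_pow, inv_pow]
        field_simp
      rw [h2, neg_mul, Real.exp_neg]
      exact inv_anti₀ (by positivity) h1
  refine ne_top_of_le_ne_top ?_ hle
  rw [ENNReal.tsum_add, tsum_ite_eq]
  exact ENNReal.add_ne_top.2 ⟨by simp, hs2⟩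

lemma qbound (hn : 500 ≤ n) :
    Real.exp (-((51 / 625) * ((n : ℝ) / 2))) * ((676 / 625) : ℝ) ^ ((n : ℝ) / 2) ≤ 1 / 2 := by
  have hn' : (250 : ℝ) ≤ (n : ℝ) / 2 := by
    have : (500 : ℝ) ≤ n := by exact_mod_cast hn
    linarith
  have hq : (0 : ℝ) < Real.exp (-(51 / 625)) * (676 / 625) := by positivity
  have hq1 : Real.exp (-(51 / 625)) * (676 / 625) ≤ 1 := by
    have := Real.add_one_le_exp ((51 / 625) : ℝ)
    rw [Real.exp_neg, inv_mul_le_iff₀ (Real.exp_pos _)]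
    linarith
  have e : Real.exp (-((51 / 625) * ((n : ℝ) / 2))) * ((676 / 625) : ℝ) ^ ((n : ℝ) / 2) =
      (Real.exp (-(51 / 625)) * (676 / 625)) ^ ((n : ℝ) / 2) := by
    rw [Real.mul_rpow (by positivity) (by positivity), ← Real.exp_mul]
    congr 2; ring
  rw [e]
  refine (Real.rpow_le_rpow_of_exponent_ge hq hq1 hn').trans ?_
  rw [show (250 : ℝ) = ((250 : ℕ) : ℝ) by norm_num, Real.rpow_natCast, mul_pow, ← Real.exp_nat_mul]
  rw [show ((250 : ℕ) : ℝ) * -(51 / 625) = -(((20 : ℕ) : ℝ) * 1 + 0.4) by norm_num, Real.exp_neg,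
    inv_mul_le_iff₀ (Real.exp_pos _), Real.exp_add, Real.exp_nat_mul]
  have h1 : (2.718 : ℝ) ≤ Real.exp 1 := by have := Real.exp_one_gt_d9; linarith
  have h2 : (1.48 : ℝ) ≤ Real.exp 0.4 := by
    have := Real.quadratic_le_exp_of_nonneg (show (0 : ℝ) ≤ 0.4 by norm_num)
    norm_num at this ⊢
    linarith
  have h3 : (2.718 : ℝ) ^ 20 * 1.48 ≤ Real.exp 1 ^ 20 * Real.exp 0.4 := by gcongr
  refine le_trans ?_ (mul_le_mul_of_nonneg_right h3 (by norm_num))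
  norm_num

/-- If every nonzero lattice vector is long then the Gaussian mass of `L` is at most `2`. -/
lemma gF_le_two (hn : 500 ≤ n) {b : ℝ} (hb : 0 < b)
    (hL : ∀ v : L, v ≠ 0 → (676 / 625) * (n / 2) ≤ b * ‖v‖ ^ 2) : gF L b 0 ≤ 2 := by
  classical
  set b' := b / (676 / 625) with hb'
  have hb'0 : 0 < b' := by positivity
  have hlt : b' < b := by rw [hb', div_lt_iff₀ (by norm_num)]; linarith
  set ε := Real.exp (-((51 / 625) * ((n : ℝ) / 2))) with hε
  have h1 : gF L b 0 ≤ ∑' v : L, ((if v = 0 then 1 else 0) +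
      ENNReal.ofReal ε * gG b' ((v : EuclideanSpace ℝ (Fin n)) + 0)) := by
    refine ENNReal.tsum_le_tsum fun v => ?_
    by_cases hv : v = 0
    · subst hv
      simp [gG]
    · simp only [hv, if_false, zero_add, add_zero]
      unfold gG
      rw [← ENNReal.ofReal_mul (by positivity), hε, ← Real.exp_add]
      apply ENNReal.ofReal_le_ofReal
      apply Real.exp_le_exp.2
      have : (676 / 625) * ((n : ℝ) / 2) ≤ b * ‖(v : EuclideanSpace ℝ (Fin n))‖ ^ 2 := hL v hv
      rw [hb']
      have e : b / (676 / 625) * ‖(v : EuclideanSpace ℝ (Fin n))‖ ^ 2 =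
        (b * ‖(v : EuclideanSpace ℝ (Fin n))‖ ^ 2) / (676 / 625) := by ring
      rw [neg_mul, neg_mul, e]
      linarith
  rw [ENNReal.tsum_add, tsum_ite_eq, ENNReal.tsum_mul_left] at h1
  have h2 := gF_scale L hb'0 hlt
  have e : b / b' = (676 / 625) := by rw [hb']; field_simp
  rw [e] at h2
  have h3 : gF L b 0 ≤ 1 + ENNReal.ofReal (1 / 2) * gF L b 0 := by
    refine h1.trans ?_
    refine add_le_add le_rfl ?_
    refine (mul_le_mul_right h2 _).trans ?_
    rw [← mul_assoc, ← ENNReal.ofReal_mul (by positivity)]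
    gcongr
    exact qbound hn
  have hfin := gF_ne_top L hb 0
  lift gF L b 0 to NNReal using hfin with f
  rw [← ENNReal.ofReal_coe_nnreal, ← ENNReal.ofReal_mul (by norm_num), ← ENNReal.ofReal_one,
    ← ENNReal.ofReal_add (by norm_num) (by positivity),
    ENNReal.ofReal_le_ofReal_iff (by positivity)] at h3
  rw [← ENNReal.ofReal_coe_nnreal, show (2 : ℝ≥0∞) = ENNReal.ofReal 2 by simp]
  apply ENNReal.ofReal_le_ofReal
  linarith

lemma rhoSet_coset (s : ℝ) (x : EuclideanSpace ℝ (Fin n)) :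
    rhoSet s (coset L x) = (gF L (Real.pi / s ^ 2) x).toReal := by
  unfold rhoSet coset gF
  rw [ENNReal.tsum_toReal_eq (fun v => by simp [gG])]
  have hinj : Set.InjOn (fun v : EuclideanSpace ℝ (Fin n) => v + x)
      (L : Set (EuclideanSpace ℝ (Fin n))) := fun a _ b _ h => add_right_cancel h
  rw [← (Equiv.Set.imageOfInjOn _ _ hinj).tsum_eq]
  refine tsum_congr fun v => ?_
  simp only [gG, rho, Equiv.Set.imageOfInjOn, Equiv.coe_fn_mk]
  rw [ENNReal.toReal_ofReal (by positivity)]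
  congr 1
  ring

end

/-- Improved distinguishing inequality: for `n ≥ 500`, `c ≥ 1`, `k ≥ 1.04`,
if `r_x ≥ cs√(n/2π)` and `λ₁(L) ≥ kcs√(n/2π)`, then
`ρ_s(r_x) ≤ ρ_s(L+x)/ρ_s(L) ≤ 2(e^{1-c²})^{n/2}`. -/
theorem distinguishing_improved_specific (n : ℕ) (hn : 500 ≤ n)
    (L : Submodule ℤ (EuclideanSpace ℝ (Fin n))) [DiscreteTopology L] [IsZLattice ℝ L]
    (s : ℝ) (hs : 0 < s) (x : EuclideanSpace ℝ (Fin n)) (rx : ℝ)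
    (hrx : rx = Metric.infDist x (L : Set (EuclideanSpace ℝ (Fin n))))
    (c : ℝ) (hc : 1 ≤ c) (k : ℝ) (hk : 1.04 ≤ k)
    (hr : c * s * Real.sqrt (n / (2 * Real.pi)) ≤ rx)
    (hlam : k * c * s * Real.sqrt (n / (2 * Real.pi)) ≤ lambdaOne L) :
    rhoR s rx ≤
        rhoSet s (coset L x) / rhoSet s (L : Set (EuclideanSpace ℝ (Fin n))) ∧
      rhoSet s (coset L x) / rhoSet s (L : Set (EuclideanSpace ℝ (Fin n))) ≤
        2 * Real.exp (1 - c ^ 2) ^ ((n : ℝ) / 2) := by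
  have hpi := Real.pi_pos
  have hc0 : 0 < c := by linarith
  set b := Real.pi / s ^ 2 with hb
  have hb0 : 0 < b := by positivity
  have hL0 : rhoSet s (L : Set (EuclideanSpace ℝ (Fin n))) = (gF L b 0).toReal := by
    rw [← rhoSet_coset]
    congr 1
    simp [coset]
  rw [hL0, rhoSet_coset, ← hb]
  have hfin := fun y => gF_ne_top L hb0 y
  have hone : 1 ≤ gF L b 0 := by
    have := ENNReal.le_tsum (f := fun v : L => gG b ((v : EuclideanSpace ℝ (Fin n)) + 0)) 0
    simpa [gG, gF] using this
  have honeR : 1 ≤ (gF L b 0).toReal := by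
    rw [← ENNReal.toReal_one]
    exact ENNReal.toReal_mono (hfin 0) hone
  constructor
  · have hcl : IsClosed (L : Set (EuclideanSpace ℝ (Fin n))) :=
      @AddSubgroup.isClosed_of_discrete _ _ _ _ _
        L.toAddSubgroup (inferInstanceAs (DiscreteTopology L))
    obtain ⟨y, hyL, hy⟩ := hcl.exists_infDist_eq_dist ⟨0, L.zero_mem⟩ x
    rw [le_div_iff₀ (by linarith)]
    have h := gF_lower L (b := b) (x - y)
    have e : gF L b (x - y) = gF L b x := by
      have := gF_add L b ⟨y, hyL⟩ (x - y)
      rw [← this]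
      simp
    rw [e] at h
    have h2 := ENNReal.toReal_mono (hfin x) h
    rw [ENNReal.toReal_mul] at h2
    have e3 : rhoR s rx = (gG b (x - y)).toReal := by
      unfold gG
      rw [ENNReal.toReal_ofReal (by positivity), rhoR, hrx, hy, dist_eq_norm, hb]
      congr 1
      ring
    rw [e3]
    exact h2
  · refine (div_le_self (by positivity) honeR).trans ?_
    have hsq : Real.sqrt (n / (2 * Real.pi)) ^ 2 = n / (2 * Real.pi) :=
      Real.sq_sqrt (by positivity)
    set t := Real.sqrt (n / (2 * Real.pi)) with ht
    have ht0 : 0 ≤ t := Real.sqrt_nonneg _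
    have hn1 : Real.pi * t ^ 2 = n / 2 := by rw [hsq]; field_simp
    have hbs : b * s ^ 2 = Real.pi := by rw [hb]; field_simp
    set b1 := b / c ^ 2 with hb1
    have hb10 : 0 < b1 := by positivity
    have hb1c : b1 * c ^ 2 = b := by rw [hb1]; field_simp
    have htwo : gF L b1 0 ≤ 2 := by
      refine gF_le_two L hn hb10 fun v hv => ?_
      have h1 : lambdaOne L ≤ ‖v‖ := by
        refine csInf_le ⟨0, ?_⟩ ⟨v, v.2, by simpa using hv, rfl⟩
        rintro r ⟨w, -, -, rfl⟩
        exact norm_nonneg _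
      have h2 : 1.04 * (c * s * t) ≤ ‖v‖ := by
        have : 1.04 * (c * s * t) ≤ k * (c * s * t) := by gcongr
        linarith
      calc (676 / 625) * ((n : ℝ) / 2) = b1 * (1.04 * (c * s * t)) ^ 2 := by
            rw [← hn1, ← hbs, ← hb1c]; ring
        _ ≤ _ := by gcongr
    have hE : Real.exp (1 - c ^ 2) ^ ((n : ℝ) / 2) = Real.exp ((1 - c ^ 2) * (n / 2)) := by
      rw [← Real.exp_mul]
    rw [hE]
    set ε := Real.exp ((1 - c ^ 2) * ((n : ℝ) / 2)) with hε
    have hmain : gF L b x ≤ ENNReal.ofReal ε * gF L b1 x := by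
      unfold gF
      rw [← ENNReal.tsum_mul_left]
      refine ENNReal.tsum_le_tsum fun v => ?_
      unfold gG
      rw [← ENNReal.ofReal_mul (by positivity), hε, ← Real.exp_add]
      apply ENNReal.ofReal_le_ofReal
      apply Real.exp_le_exp.2
      have h1 : rx ≤ ‖(v : EuclideanSpace ℝ (Fin n)) + x‖ := by
        rw [hrx]
        refine (Metric.infDist_le_dist_of_mem (L.neg_mem v.2)).trans ?_
        rw [dist_eq_norm, sub_neg_eq_add, add_comm]
      have h2 : (c * s * t) ^ 2 ≤ ‖(v : EuclideanSpace ℝ (Fin n)) + x‖ ^ 2 := by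
        have := hr.trans h1
        gcongr
      have h3 : 0 ≤ b1 * (c ^ 2 - 1) := mul_nonneg hb10.le (by nlinarith)
      have h4 := mul_le_mul_of_nonneg_left h2 h3
      have h5 : b1 * (c ^ 2 - 1) * (c * s * t) ^ 2 = (c ^ 2 - 1) * ((n : ℝ) / 2) := by
        rw [← hn1, ← hbs, ← hb1c]; ring
      rw [h5] at h4
      have h6 : b * ‖(v : EuclideanSpace ℝ (Fin n)) + x‖ ^ 2 =
        b1 * (c ^ 2 - 1) * ‖(v : EuclideanSpace ℝ (Fin n)) + x‖ ^ 2 +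
          b1 * ‖(v : EuclideanSpace ℝ (Fin n)) + x‖ ^ 2 := by
        rw [← hb1c]; ring
      rw [neg_mul, neg_mul, h6]
      linarith
    have hfinal : gF L b x ≤ ENNReal.ofReal (2 * ε) := by
      refine hmain.trans ?_
      rw [mul_comm 2 ε, ENNReal.ofReal_mul (by positivity)]
      gcongr
      simpa using (gF_le L hb10 x).trans htwo
    exact ENNReal.toReal_le_of_le_ofReal (by positivity) hfinal
end
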